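/- arXiv:1009.2923 — 7 statements merged into one kernel-verified Lean document; each statement's English description precedes it below -/
import Mathlib

section
/- Let (X_m)_{m∈ℕ} be a sequence of Banach spaces and let T_m : X_m → L¹ (m ∈ ℕ) be a sequence of bounded operators with sup_m ‖T_m‖ < ∞. Then at least one of the following holds: (i) the identity operators id_{ℓ₁ᵏ} (k ∈ ℕ) uniformly factor through the T_m, i.e. there exists C > 0 such that for every k ∈ ℕ there are m ∈ ℕ and bounded operators A : ℓ₁ᵏ → X_m and B : L¹ → ℓ₁ᵏ with B ∘ T_m ∘ A = id_{ℓ₁ᵏ} and ‖A‖·‖B‖ ≤ C; or (ii) the T_m have uniform approximate lattice bounds. -/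
open MeasureTheory

noncomputable section

/-- Lebesgue measure on `[0,1]`. -/
abbrev μ01 : Measure ℝ := volume.restrict (Set.Icc 0 1)

/-- The space `L¹[0,1]`. -/
abbrev L1 : Type := Lp ℝ 1 μ01

/-- `ℓ₁ᵏ`, i.e. `ℝᵏ` with the norm `‖a‖₁ = ∑ |aᵢ|`. -/
abbrev ell1 (k : ℕ) : Type := PiLp 1 (fun _ : Fin k => ℝ)

/-- A family of operators `T_m : X_m → L¹` has *uniform approximate lattice bounds* if for
every `ε > 0` there is `C > 0` and, for each `m`, a nonnegative `g_m ∈ L¹` with `‖g_m‖₁ ≤ C`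
such that `‖(|T_m x| − g_m)⁺‖₁ ≤ ε` for all `x` in the closed unit ball of `X_m`. -/
def UniformApproxLatticeBounds {X : ℕ → Type*} [∀ m, NormedAddCommGroup (X m)]
    [∀ m, NormedSpace ℝ (X m)] (T : ∀ m, X m →L[ℝ] L1) : Prop :=
  ∀ ε : ℝ, 0 < ε → ∃ C : ℝ, 0 < C ∧ ∀ m : ℕ, ∃ g : L1, 0 ≤ g ∧ ‖g‖ ≤ C ∧
    ∀ x : X m, ‖x‖ ≤ 1 → ‖(|T m x| - g) ⊔ 0‖ ≤ ε

lemma gd_indep {ι : Type*} [DecidableEq ι] (R : ι → ι → Prop) [∀ i j, Decidable (R i j)] (d : ℕ) :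
    ∀ (k : ℕ) (V : Finset ι), k * (2 * d + 1) ≤ V.card →
      (∀ j ∈ V, (V.filter (fun i => R i j)).card ≤ d) →
      ∃ S ⊆ V, S.card = k ∧ ∀ i ∈ S, ∀ j ∈ S, i ≠ j → ¬ R i j := by
  intro k
  induction k with
  | zero => intro V _ _; exact ⟨∅, by simp, by simp, by simp⟩
  | succ k ih =>
    intro V hV hd
    have hne : V.Nonempty := by
      rw [← Finset.card_pos]; have : 0 < (k+1) * (2*d+1) := by positivity
      omega
    have hi : ∃ i ∈ V, (V.filter (fun j => R i j)).card ≤ d := by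
      apply Finset.exists_le_of_sum_le hne
      have := Finset.sum_card_bipartiteAbove_eq_sum_card_bipartiteBelow (s := V) (t := V) R
      simp only [Finset.bipartiteAbove, Finset.bipartiteBelow] at this
      rw [this]
      exact Finset.sum_le_sum hd
    obtain ⟨i, hiV, hi⟩ := hi
    set U := insert i (V.filter (fun j => R i j) ∪ V.filter (fun j => R j i)) with hU
    have hUc : U.card ≤ 2 * d + 1 := by
      have h1 : U.card ≤ _ := Finset.card_insert_le i (V.filter (fun j => R i j) ∪ V.filter (fun j => R j i))
      have h2 := Finset.card_union_le (V.filter (fun j => R i j)) (V.filter (fun j => R j i))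
      have h3 := hd i hiV
      omega
    obtain ⟨S, hS, hSc, hSR⟩ := ih (V \ U) (by
      have := Finset.le_card_sdiff U V
      have e : (k+1) * (2*d+1) = k * (2*d+1) + (2*d+1) := by ring
      omega) (fun j hj => (Finset.card_le_card
        (Finset.filter_subset_filter _ Finset.sdiff_subset)).trans (hd j (Finset.sdiff_subset hj)))
    have hiS : i ∉ S := fun h => by
      have := hS h
      simp [hU] at this
    have key : ∀ j ∈ S, ¬ R i j ∧ ¬ R j i := by
      intro j hj
      have := hS hj
      simp only [hU, Finset.mem_sdiff, Finset.mem_insert, Finset.mem_union, Finset.mem_filter] at this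
      tauto
    refine ⟨insert i S, ?_, by rw [Finset.card_insert_of_notMem hiS, hSc], ?_⟩
    · exact Finset.insert_subset hiV (hS.trans Finset.sdiff_subset)
    · intro a ha b hb hab
      rw [Finset.mem_insert] at ha hb
      rcases ha with rfl | ha <;> rcases hb with rfl | hb
      · exact absurd rfl hab
      · exact (key b hb).1
      · exact (key a ha).2
      · exact hSR a ha b hb hab

lemma gd_rosenthal (k : ℕ) (M η : ℝ) (hη : 0 < η) : ∃ n : ℕ, ∀ a : Fin n → Fin n → ℝ,
    (∀ i j, 0 ≤ a i j) → (∀ j, ∑ i, a i j ≤ M) →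
    ∃ s : Fin k → Fin n, Function.Injective s ∧
      ∀ j, ∑ i, (if i = j then 0 else a (s i) (s j)) ≤ η := by
  classical
  set c : ℝ := η / (k + 1) with hc
  have hc0 : 0 < c := by positivity
  obtain ⟨d, hd⟩ := exists_nat_ge (M / c)
  refine ⟨k * (2 * d + 1), fun a ha hM => ?_⟩
  obtain ⟨S, -, hSc, hS⟩ := gd_indep (fun i j => c < a i j) d k Finset.univ (by simp) (by
    intro j _
    have h1 : ((Finset.univ.filter (fun i => c < a i j)).card : ℝ) * c ≤ M := by
      rw [← nsmul_eq_mul]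
      calc _ ≤ ∑ i ∈ Finset.univ.filter (fun i => c < a i j), a i j :=
            Finset.card_nsmul_le_sum _ _ _ (fun i hi => (Finset.mem_filter.1 hi).2.le)
        _ ≤ ∑ i, a i j := Finset.sum_le_sum_of_subset_of_nonneg (Finset.filter_subset _ _)
            (fun i _ _ => ha i j)
        _ ≤ M := hM j
    have h2 := ((le_div_iff₀ hc0).2 h1).trans hd
    exact_mod_cast h2)
  refine ⟨fun i => S.orderEmbOfFin hSc i, (S.orderEmbOfFin hSc).injective, fun j => ?_⟩
  calc _ ≤ ∑ i : Fin k, c := by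
        apply Finset.sum_le_sum
        intro i _
        split_ifs with h
        · exact hc0.le
        · exact not_lt.1 (hS _ (Finset.orderEmbOfFin_mem _ _ _) _ (Finset.orderEmbOfFin_mem _ _ _)
            (fun e => h ((S.orderEmbOfFin hSc).injective e)))
    _ = k * c := by simp
    _ ≤ η := by
        rw [hc, mul_div_assoc', div_le_iff₀ (by positivity)]
        nlinarith

lemma gd_seq {X : Type*} [NormedAddCommGroup X] [NormedSpace ℝ X] (T : X →L[ℝ] L1)
    (M ε L C : ℝ) (n : ℕ) (hL : 0 ≤ L) (hTM : ‖T‖ ≤ M) (hC : L * (n * M) ≤ C)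
    (H : ∀ g : L1, 0 ≤ g → ‖g‖ ≤ C → ∃ x : X, ‖x‖ ≤ 1 ∧ ε < ‖(|T x| - g) ⊔ 0‖) :
    ∃ x : ℕ → X, (∀ j, ‖x j‖ ≤ 1) ∧ ∀ j < n,
      ε < ‖(|T (x j)| - L • ∑ i ∈ Finset.range j, |T (x i)|) ⊔ 0‖ := by
  have H' : ∀ g : L1, ∃ x : X, ‖x‖ ≤ 1 ∧ (0 ≤ g → ‖g‖ ≤ C → ε < ‖(|T x| - g) ⊔ 0‖) := by
    intro g
    by_cases h : 0 ≤ g ∧ ‖g‖ ≤ C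
    · obtain ⟨x, h1, h2⟩ := H g h.1 h.2
      exact ⟨x, h1, fun _ _ => h2⟩
    · exact ⟨0, by simp, fun h1 h2 => absurd ⟨h1, h2⟩ h⟩
  choose x hx1 hx2 using H'
  let G : ℕ → L1 := fun j => Nat.rec 0 (fun _ g => g + |T (x (L • g))|) j
  have hG : ∀ j, G j = ∑ i ∈ Finset.range j, |T (x (L • G i))| := by
    intro j
    induction j with
    | zero => rfl
    | succ j ih => rw [Finset.sum_range_succ, ← ih]
  have hM : 0 ≤ M := (norm_nonneg _).trans hTM
  refine ⟨fun j => x (L • G j), fun j => hx1 _, fun j hj => ?_⟩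
  simp only
  rw [← hG]
  apply hx2
  · have h0 : 0 ≤ G j := by
      rw [hG]
      exact Finset.sum_nonneg (fun i _ => abs_nonneg _)
    rw [← Lp.coeFn_nonneg] at h0 ⊢
    filter_upwards [h0, Lp.coeFn_smul L (G j)] with t h1 h2
    rw [h2, Pi.smul_apply, smul_eq_mul]
    exact mul_nonneg hL h1
  · rw [norm_smul, Real.norm_of_nonneg hL]
    refine le_trans (mul_le_mul_of_nonneg_left ?_ hL) hC
    rw [hG]
    calc _ ≤ ∑ i ∈ Finset.range j, ‖|T (x (L • G i))|‖ := norm_sum_le _ _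
      _ ≤ ∑ i ∈ Finset.range j, M := by
        apply Finset.sum_le_sum
        intro i _
        rw [norm_abs_eq_norm]
        exact (T.le_of_opNorm_le hTM _).trans (mul_le_of_le_one_right hM (hx1 _))
      _ = j * M := by simp
      _ ≤ n * M := by gcongr

lemma gd_disj {n : ℕ} (f : Fin n → ℝ → ℝ) (hf : ∀ i, Measurable (f i))
    (hfi : ∀ i, Integrable (f i) μ01) (M L ε : ℝ) (hL : 0 < L) (hM : ∀ i, ∫ t, |f i t| ∂μ01 ≤ M)
    (hLM : n * M / L ≤ ε / 2)
    (hε : ∀ j, ε ≤ ∫ t, max (|f j t| - L * ∑ i with i < j, |f i t|) 0 ∂μ01) :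
    ∃ E : Fin n → Set ℝ, (∀ i, MeasurableSet (E i)) ∧ (∀ i j, i ≠ j → Disjoint (E i) (E j)) ∧
      ∀ j, ε / 2 ≤ ∫ t in E j, |f j t| ∂μ01 := by
  let F : Fin n → Set ℝ := fun j => {t | L * ∑ i with i < j, |f i t| < |f j t|}
  have hF : ∀ j, MeasurableSet (F j) := by
    intro j
    apply measurableSet_lt
    · exact (Finset.measurable_sum _ (fun i _ => (hf i).abs)).const_mul L
    · exact (hf j).abs
  let E : Fin n → Set ℝ := fun j => F j \ ⋃ i, ⋃ (_ : j < i), F i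
  have hE : ∀ j, MeasurableSet (E j) := fun j =>
    (hF j).diff (MeasurableSet.iUnion fun i => MeasurableSet.iUnion fun _ => hF i)
  have hlt : ∀ i j, i < j → Disjoint (E i) (E j) := by
    intro i j hij
    rw [Set.disjoint_left]
    intro t ht ht'
    exact ht.2 (Set.mem_iUnion₂.2 ⟨j, hij, ht'.1⟩)
  refine ⟨E, hE, fun i j hij => ?_, fun j => ?_⟩
  · rcases lt_or_gt_of_ne hij with h | h
    · exact hlt _ _ h
    · exact (hlt _ _ h).symm
  have hpt : ∀ t, max (|f j t| - L * ∑ i with i < j, |f i t|) 0 ≤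
      (E j).indicator (fun t => |f j t|) t + ∑ i, |f i t| / L := by
    intro t
    have hs : 0 ≤ ∑ i, |f i t| / L := Finset.sum_nonneg (fun i _ => by positivity)
    have hs' : 0 ≤ L * ∑ i with i < j, |f i t| :=
      mul_nonneg hL.le (Finset.sum_nonneg (fun i _ => abs_nonneg _))
    have hi : 0 ≤ (E j).indicator (fun t => |f j t|) t :=
      Set.indicator_nonneg (fun _ _ => abs_nonneg _) _
    apply max_le _ (by positivity)
    by_cases h1 : t ∈ F j
    · by_cases h2 : t ∈ E j
      · rw [Set.indicator_of_mem h2]; linarith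
      · have : t ∈ ⋃ i, ⋃ (_ : j < i), F i := by
          by_contra h; exact h2 ⟨h1, h⟩
        obtain ⟨i, hij, hti⟩ := Set.mem_iUnion₂.1 this
        have h3 : |f j t| ≤ ∑ l with l < i, |f l t| :=
          Finset.single_le_sum (f := fun l => |f l t|) (fun _ _ => abs_nonneg _)
            (by simpa using hij)
        have h4 : L * ∑ l with l < i, |f l t| < |f i t| := hti
        have h5 : |f j t| ≤ |f i t| / L := by
          rw [le_div_iff₀ hL]; nlinarith
        have h6 : |f i t| / L ≤ ∑ i, |f i t| / L :=
          Finset.single_le_sum (f := fun l => |f l t| / L) (fun _ _ => by positivity)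
            (Finset.mem_univ i)
        linarith
    · have : |f j t| ≤ L * ∑ i with i < j, |f i t| := not_lt.1 h1
      linarith
  have hInt1 : Integrable ((E j).indicator (fun t => |f j t|)) μ01 := (hfi j).abs.indicator (hE j)
  have hInt2 : Integrable (fun t => ∑ i, |f i t| / L) μ01 :=
    integrable_finsetSum _ (fun i _ => (hfi i).abs.div_const L)
  have h1 : ∫ t, max (|f j t| - L * ∑ i with i < j, |f i t|) 0 ∂μ01 ≤
      ∫ t, ((E j).indicator (fun t => |f j t|) t + ∑ i, |f i t| / L) ∂μ01 :=
    integral_mono_of_nonneg (Filter.Eventually.of_forall fun t => le_max_right _ _)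
      (hInt1.add hInt2) (Filter.Eventually.of_forall hpt)
  rw [integral_add hInt1 hInt2, integral_indicator (hE j),
    integral_finsetSum _ (fun i _ => (hfi i).abs.div_const L)] at h1
  have h2 : ∑ i, ∫ t, |f i t| / L ∂μ01 ≤ n * M / L := by
    calc _ ≤ ∑ i : Fin n, M / L := by
          apply Finset.sum_le_sum
          intro i _
          rw [integral_div]
          gcongr
          exact hM i
      _ = _ := by simp [mul_div_assoc]
  have := hε j
  linarith

lemma gd_B {k : ℕ} (w : Fin k → ℝ → ℝ) (hw : ∀ i, Measurable (w i)) (D : ℝ)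
    (hD0 : 0 ≤ D) (hD : ∀ t, ∑ i, |w i t| ≤ D) :
    ∃ B : L1 →L[ℝ] ell1 k, ‖B‖ ≤ D ∧ ∀ h i, B h i = ∫ t, w i t * h t ∂μ01 := by
  have hwi : ∀ i t, |w i t| ≤ D := fun i t =>
    (Finset.single_le_sum (f := fun i => |w i t|) (fun _ _ => abs_nonneg _)
      (Finset.mem_univ i)).trans (hD t)
  have hInt : ∀ i (h : L1), Integrable (fun t => w i t * h t) μ01 := fun i h =>
    (L1.integrable_coeFn h).bdd_mul (hw i).aestronglyMeasurable
      (Filter.Eventually.of_forall (hwi i))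
  let B0 : L1 →ₗ[ℝ] ell1 k :=
    { toFun := fun h => WithLp.toLp 1 (fun i => ∫ t, w i t * h t ∂μ01)
      map_add' := by
        intro g h
        ext i
        simp only [PiLp.add_apply]
        rw [← integral_add (hInt i g) (hInt i h)]
        apply integral_congr_ae
        filter_upwards [Lp.coeFn_add g h] with t ht
        rw [ht, Pi.add_apply]; ring
      map_smul' := by
        intro c h
        ext i
        simp only [PiLp.smul_apply, RingHom.id_apply, smul_eq_mul]
        rw [← integral_const_mul]
        apply integral_congr_ae
        filter_upwards [Lp.coeFn_smul c h] with t ht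
        rw [ht, Pi.smul_apply, smul_eq_mul]; ring }
  have hB0 : ∀ h, ‖B0 h‖ ≤ D * ‖h‖ := by
    intro h
    rw [PiLp.norm_eq_of_L1, L1.norm_eq_integral_norm, ← integral_const_mul]
    calc ∑ i, ‖B0 h i‖ ≤ ∑ i, ∫ t, ‖w i t * h t‖ ∂μ01 :=
          Finset.sum_le_sum (fun i _ => norm_integral_le_integral_norm _)
      _ = ∫ t, ∑ i, ‖w i t * h t‖ ∂μ01 :=
          (integral_finsetSum _ (fun i _ => (hInt i h).norm)).symm
      _ ≤ _ := by
          apply integral_mono (integrable_finsetSum _ (fun i _ => (hInt i h).norm))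
            ((L1.integrable_coeFn h).norm.const_mul D)
          intro t
          simp only [norm_mul, ← Finset.sum_mul]
          exact mul_le_mul_of_nonneg_right (hD t) (norm_nonneg _)
  exact ⟨B0.mkContinuous D hB0, LinearMap.mkContinuous_norm_le _ hD0 _, fun h i => rfl⟩

lemma gd_A {k : ℕ} {X : Type*} [NormedAddCommGroup X] [NormedSpace ℝ X] (x : Fin k → X)
    (hx : ∀ i, ‖x i‖ ≤ 1) :
    ∃ A : ell1 k →L[ℝ] X, ‖A‖ ≤ 1 ∧ ∀ a, A a = ∑ i, a i • x i := by
  let A0 : ell1 k →ₗ[ℝ] X :=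
    { toFun := fun a => ∑ i, a i • x i
      map_add' := by intro a b; simp [add_smul, Finset.sum_add_distrib]
      map_smul' := by intro c a; simp [mul_smul, Finset.smul_sum] }
  have hA0 : ∀ a, ‖A0 a‖ ≤ 1 * ‖a‖ := by
    intro a
    rw [PiLp.norm_eq_of_L1, one_mul]
    have e0 : A0 a = ∑ i, a i • x i := rfl
    rw [e0]
    refine (norm_sum_le (E := X) _ _).trans (Finset.sum_le_sum fun i _ => ?_)
    rw [norm_smul]
    exact mul_le_of_le_one_right (norm_nonneg _) (hx i)
  exact ⟨A0.mkContinuous 1 hA0, LinearMap.mkContinuous_norm_le _ zero_le_one _, fun a => rfl⟩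

lemma gd_inv {k : ℕ} (P : ell1 k →L[ℝ] ell1 k)
    (hP : ∀ a : ell1 k, ‖a - P a‖ ≤ 1 / 2 * ‖a‖) :
    ∃ Q : ell1 k →L[ℝ] ell1 k, Q.comp P = ContinuousLinearMap.id ℝ _ ∧ ‖Q‖ ≤ 2 := by
  have ht : ‖(1 : ell1 k →L[ℝ] ell1 k) - P‖ ≤ 1 / 2 := ContinuousLinearMap.opNorm_le_bound _ (by norm_num) (by
    intro a; simpa using hP a)
  let u := Units.oneSub (1 - P) (by linarith)
  have hu : (u : ell1 k →L[ℝ] ell1 k) = P := by simp [u]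
  have h1 : (↑u⁻¹ : ell1 k →L[ℝ] ell1 k) * P = 1 := by rw [← hu]; exact u.inv_mul
  refine ⟨↑u⁻¹, h1, ?_⟩
  set Q : ell1 k →L[ℝ] ell1 k := ↑u⁻¹
  have h2 : Q = 1 + Q * (1 - P) := by rw [mul_sub, h1]; simp
  have h3 : ‖Q‖ ≤ 1 + ‖Q‖ * (1 / 2) := by
    calc ‖Q‖ = ‖1 + Q * (1 - P)‖ := by rw [← h2]
      _ ≤ ‖(1 : ell1 k →L[ℝ] ell1 k)‖ + ‖Q * (1 - P)‖ := norm_add_le _ _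
      _ ≤ 1 + ‖Q‖ * (1 / 2) := by
        apply add_le_add ContinuousLinearMap.norm_id_le
        exact (norm_mul_le _ _).trans (mul_le_mul_of_nonneg_left ht (norm_nonneg _))
  linarith

lemma gd_factor {k : ℕ} {X : Type*} [NormedAddCommGroup X] [NormedSpace ℝ X] (T : X →L[ℝ] L1)
    (x : Fin k → X) (hx : ∀ i, ‖x i‖ ≤ 1) (E : Fin k → Set ℝ) (hE : ∀ i, MeasurableSet (E i))
    (hdis : ∀ i j, i ≠ j → Disjoint (E i) (E j)) (δ : ℝ) (hδ : 0 < δ)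
    (hd : ∀ i, δ ≤ ∫ t in E i, |T (x i) t| ∂μ01)
    (ho : ∀ j, ∑ i, (if i = j then 0 else ∫ t in E i, |T (x j) t| ∂μ01) ≤ δ / 2) :
    ∃ A : ell1 k →L[ℝ] X, ∃ B : L1 →L[ℝ] ell1 k,
      B.comp (T.comp A) = ContinuousLinearMap.id ℝ (ell1 k) ∧ ‖A‖ * ‖B‖ ≤ 2 / δ := by
  let c : Fin k → ℝ := fun i => ∫ t in E i, |T (x i) t| ∂μ01
  have hc0 : ∀ i, 0 < c i := fun i => hδ.trans_le (hd i)
  let w : Fin k → ℝ → ℝ := fun i => (E i).indicator (fun t => Real.sign (T (x i) t) / c i)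
  have hmeas : ∀ h : L1, Measurable h := fun h => (Lp.stronglyMeasurable h).measurable
  have hsign : Measurable Real.sign := by
    unfold Real.sign
    exact Measurable.ite measurableSet_Iio measurable_const
      (Measurable.ite measurableSet_Ioi measurable_const measurable_const)
  have hs1 : ∀ r : ℝ, |Real.sign r| ≤ 1 := by
    intro r
    rcases Real.sign_apply_eq r with h | h | h <;> simp [h]
  have hw : ∀ i, Measurable (w i) := fun i =>
    ((hsign.comp (hmeas _)).div_const _).indicator (hE i)
  have hwb : ∀ i t, |w i t| ≤ (E i).indicator (fun _ => 1 / δ) t := by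
    intro i t
    by_cases h : t ∈ E i
    · simp only [w, Set.indicator_of_mem h, abs_div, abs_of_pos (hc0 i)]
      exact div_le_div₀ zero_le_one (hs1 _) hδ (hd i)
    · simp [w, h]
  have hD : ∀ t, ∑ i, |w i t| ≤ 1 / δ := by
    intro t
    by_cases h : ∃ i, t ∈ E i
    · obtain ⟨i, hi⟩ := h
      rw [Finset.sum_eq_single i]
      · simpa [hi] using hwb i t
      · intro j _ hj
        have : t ∉ E j := fun h => Set.disjoint_left.1 (hdis j i hj) h hi
        simp [w, this]
      · simp
    · push Not at h
      simp [w, h]; positivity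
  obtain ⟨B, hBn, hB⟩ := gd_B w hw (1 / δ) (by positivity) hD
  obtain ⟨A, hAn, hA⟩ := gd_A x hx
  have hdiag : ∀ i, B (T (x i)) i = 1 := by
    intro i
    rw [hB]
    have : ∀ t, w i t * T (x i) t = (E i).indicator (fun t => |T (x i) t| / c i) t := by
      intro t
      by_cases h : t ∈ E i
      · simp only [w, Set.indicator_of_mem h]
        have : Real.sign (T (x i) t) * T (x i) t = |T (x i) t| := by
          rcases lt_trichotomy (T (x i) t) 0 with h | h | h
          · rw [Real.sign_of_neg h, abs_of_neg h]; ring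
          · simp [h]
          · rw [Real.sign_of_pos h, abs_of_pos h]; ring
        rw [← this]; ring
      · simp [w, h]
    simp_rw [this]
    rw [integral_indicator (hE i), integral_div]
    exact div_self (hc0 i).ne'
  have hoff : ∀ i j, |B (T (x j)) i| ≤ 1 / δ * ∫ t in E i, |T (x j) t| ∂μ01 := by
    intro i j
    rw [hB, ← integral_const_mul, ← integral_indicator (hE i)]
    rw [← Real.norm_eq_abs]
    apply norm_integral_le_of_norm_le
    · exact ((L1.integrable_coeFn (T (x j))).abs.const_mul _).indicator (hE i)
    · refine Filter.Eventually.of_forall fun t => ?_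
      rw [norm_mul, Real.norm_eq_abs, Real.norm_eq_abs]
      have := mul_le_mul_of_nonneg_right (hwb i t) (abs_nonneg (T (x j) t))
      refine this.trans (le_of_eq ?_)
      by_cases h : t ∈ E i <;> simp [h]
  obtain ⟨Q, hQ, hQn⟩ := gd_inv (B.comp (T.comp A)) (by
    intro a
    rw [PiLp.norm_eq_of_L1, PiLp.norm_eq_of_L1, Finset.mul_sum]
    have e : ∀ i, (a - (B.comp (T.comp A)) a) i
        = - ∑ j, (if i = j then 0 else a j * B (T (x j)) i) := by
      intro i
      have e1 : (B.comp (T.comp A)) a = ∑ j, a j • B (T (x j)) := by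
        simp [hA, map_sum]
      have e2 : (∑ j, a j • B (T (x j))) i = ∑ j, a j * B (T (x j)) i := by
        simp
      have e3 : ∑ j, a j * B (T (x j)) i =
          a i + ∑ j, (if i = j then 0 else a j * B (T (x j)) i) := by
        have : a i = ∑ j, (if i = j then a j * B (T (x j)) i else 0) := by
          simp [hdiag]
        rw [this, ← Finset.sum_add_distrib]
        refine Finset.sum_congr rfl fun j _ => ?_
        split_ifs <;> simp
      rw [e1, PiLp.sub_apply, e2, e3]; ring
    simp_rw [e]
    calc ∑ i, ‖- ∑ j, (if i = j then 0 else a j * B (T (x j)) i)‖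
        ≤ ∑ i, ∑ j, ‖a j‖ * (1 / δ * (if i = j then 0 else ∫ t in E i, |T (x j) t| ∂μ01)) := by
          refine Finset.sum_le_sum fun i _ => ?_
          rw [norm_neg]
          refine (norm_sum_le _ _).trans (Finset.sum_le_sum fun j _ => ?_)
          split_ifs with h
          · simp
          · rw [norm_mul]
            exact mul_le_mul_of_nonneg_left (hoff i j) (norm_nonneg _)
      _ = ∑ j, ‖a j‖ * (1 / δ * ∑ i, (if i = j then 0 else ∫ t in E i, |T (x j) t| ∂μ01)) := by
          rw [Finset.sum_comm]
          simp_rw [Finset.mul_sum]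
      _ ≤ ∑ j, ‖a j‖ * (1 / δ * (δ / 2)) := by
          refine Finset.sum_le_sum fun j _ => ?_
          have := ho j
          gcongr
      _ = ∑ j, 1 / 2 * ‖a j‖ := by
          refine Finset.sum_congr rfl fun j _ => ?_
          field_simp)
  refine ⟨A, Q.comp B, ?_, ?_⟩
  · rw [ContinuousLinearMap.comp_assoc]; exact hQ
  · calc ‖A‖ * ‖Q.comp B‖ ≤ 1 * (2 * (1 / δ)) := by
          refine mul_le_mul hAn ?_ (norm_nonneg _) zero_le_one
          exact (ContinuousLinearMap.opNorm_comp_le _ _).trans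
            (mul_le_mul hQn hBn (norm_nonneg _) (by norm_num))
      _ = 2 / δ := by ring

lemma gd_coe_sum {ι : Type*} (s : Finset ι) (g : ι → L1) :
    ∀ᵐ t ∂μ01, (∑ i ∈ s, g i : L1) t = ∑ i ∈ s, g i t := by
  classical
  induction s using Finset.induction_on with
  | empty =>
    filter_upwards [Lp.coeFn_zero ℝ 1 μ01] with t ht
    rw [Finset.sum_empty, Finset.sum_empty]; exact ht
  | insert a s ha ih =>
    rw [Finset.sum_insert ha]
    filter_upwards [ih, Lp.coeFn_add (g a) (∑ i ∈ s, g i)] with t h1 h2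
    rw [h2, Pi.add_apply, h1, Finset.sum_insert ha]

/-- **The general dichotomy theorem.** For any uniformly bounded sequence of operators
`T_m : X_m → L¹` from Banach spaces, either the identity operators on `ℓ₁ᵏ` (`k ∈ ℕ`)
uniformly factor through the `T_m`, or the `T_m` have uniform approximate lattice bounds. -/
theorem general_dichotomy {X : ℕ → Type*} [∀ m, NormedAddCommGroup (X m)]
    [∀ m, NormedSpace ℝ (X m)] [∀ m, CompleteSpace (X m)]
    (T : ∀ m, X m →L[ℝ] L1) (hT : ∃ M : ℝ, ∀ m, ‖T m‖ ≤ M) :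
    (∃ C : ℝ, 0 < C ∧ ∀ k : ℕ, ∃ m : ℕ, ∃ A : ell1 k →L[ℝ] X m, ∃ B : L1 →L[ℝ] ell1 k,
      B.comp ((T m).comp A) = ContinuousLinearMap.id ℝ (ell1 k) ∧ ‖A‖ * ‖B‖ ≤ C)
    ∨ UniformApproxLatticeBounds T := by
  obtain ⟨M₀, hM₀⟩ := hT
  let M : ℝ := max M₀ 0
  have hM0 : 0 ≤ M := le_max_right _ _
  have hM : ∀ m, ‖T m‖ ≤ M := fun m => (hM₀ m).trans (le_max_left _ _)
  by_cases hU : UniformApproxLatticeBounds T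
  · exact Or.inr hU
  left
  unfold UniformApproxLatticeBounds at hU
  push Not at hU
  obtain ⟨ε, hε, hU⟩ := hU
  refine ⟨2 / (ε / 2), by positivity, fun k => ?_⟩
  obtain ⟨n, hn⟩ := gd_rosenthal k M (ε / 2 / 2) (by positivity)
  let L : ℝ := 2 * (n * M) / ε + 1
  have hL : 0 < L := by positivity
  obtain ⟨m, hm⟩ := hU (L * (n * M) + 1) (by positivity)
  obtain ⟨x, hx1, hx2⟩ := gd_seq (T m) M ε L (L * (n * M) + 1) n hL.le (hM m) (by linarith) hm
  let f : Fin n → L1 := fun i => T m (x i)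
  have hfM : ∀ i, ∫ t, |f i t| ∂μ01 ≤ M := by
    intro i
    have h1 : ∫ t, |f i t| ∂μ01 = ‖f i‖ := by
      rw [L1.norm_eq_integral_norm]; rfl
    rw [h1]
    exact ((T m).le_of_opNorm_le (hM m) _).trans (mul_le_of_le_one_right hM0 (hx1 _))
  obtain ⟨E, hE, hdis, hd⟩ := gd_disj (fun i => f i)
    (fun i => (Lp.stronglyMeasurable (f i)).measurable)
    (fun i => L1.integrable_coeFn (f i)) M L ε hL hfM (by
      rw [div_le_iff₀ hL]
      have : ε / 2 * L = n * M + ε / 2 := by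
        simp only [L]; field_simp
      rw [this]; linarith) (by
      intro j
      refine (hx2 j j.2).le.trans (le_of_eq ?_)
      rw [L1.norm_eq_integral_norm]
      apply integral_congr_ae
      have habs : ∀ᵐ t ∂μ01, ∀ i : ℕ, (|T m (x i)| : L1) t = |T m (x i) t| :=
        ae_all_iff.2 fun i => Lp.coeFn_abs _
      filter_upwards [habs, Lp.coeFn_sup (|T m (x j)| - L • ∑ i ∈ Finset.range j, |T m (x i)|) 0,
        Lp.coeFn_sub (|T m (x j)|) (L • ∑ i ∈ Finset.range j, |T m (x i)|),
        Lp.coeFn_smul L (∑ i ∈ Finset.range j, |T m (x i)|),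
        gd_coe_sum (Finset.range j) (fun i => |T m (x i)|), Lp.coeFn_zero ℝ 1 μ01]
        with t h1 h2 h3 h4 h5 h6
      have h7 : ∑ i ∈ Finset.range j, (|T m (x i)| : L1) t = ∑ i with i < j, |f i t| := by
        simp_rw [h1]
        symm
        refine Finset.sum_bij (fun (i : Fin n) _ => (i : ℕ)) ?_ ?_ ?_ ?_
        · intro i hi; simpa using hi
        · intro a _ b _ h; exact Fin.ext h
        · intro b hb
          have hb' := Finset.mem_range.1 hb
          exact ⟨⟨b, hb'.trans j.2⟩, Finset.mem_filter.2 ⟨Finset.mem_univ _, hb'⟩, rfl⟩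
        · intro i _; rfl
      rw [h2, Pi.sup_apply, h3, Pi.sub_apply, h4, Pi.smul_apply, h5, h6, h7, h1 j]
      exact Real.norm_of_nonneg le_sup_right)
  obtain ⟨s, hs, hsum⟩ := hn (fun i j => ∫ t in E i, |f j t| ∂μ01)
    (fun i j => integral_nonneg fun t => abs_nonneg _) (by
      intro j
      have hI : Integrable (fun t => |f j t|) μ01 := (L1.integrable_coeFn (f j)).abs
      rw [← integral_iUnion_fintype hE (fun i j hij => hdis i j hij) (fun i => hI.integrableOn)]
      exact (setIntegral_le_integral hI (Filter.Eventually.of_forall fun t => abs_nonneg _)).trans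
        (hfM j))
  obtain ⟨A, B, h1, h2⟩ := gd_factor (T m) (fun i => x (s i)) (fun i => hx1 _) (fun i => E (s i))
    (fun i => hE _) (fun i j hij => hdis _ _ (fun h => hij (hs h))) (ε / 2) (by positivity)
    (fun i => hd (s i)) hsum
  exact ⟨m, A, B, h1, h2⟩

end
end

section
/- Let (X_m)_{m∈ℕ} be a sequence of Banach spaces and let T_m : X_m → L¹ (m ∈ ℕ) be bounded operators with sup_m ‖T_m‖ < ∞. Then the two alternatives of the dichotomy cannot both hold: if there exists C > 0 such that for every k ∈ ℕ there are m ∈ ℕ and bounded operators A : ℓ₁ᵏ → X_m, B : L¹ → ℓ₁ᵏ with B ∘ T_m ∘ A = id_{ℓ₁ᵏ} and ‖A‖·‖B‖ ≤ C, then the T_m do not have uniform approximate lattice bounds. -/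
open MeasureTheory

noncomputable section

/-- The functional `H ↦ ∑ᵢ (B Hᵢ)ᵢ` on `L¹(ℓ_∞ᵏ)`. -/
def PhiF {k : ℕ} (B : L1 →L[ℝ] ell1 k) : Lp (Fin k → ℝ) 1 μ01 →L[ℝ] ℝ :=
  ∑ i, ((PiLp.proj (𝕜 := ℝ) 1 (fun _ : Fin k => ℝ) i).comp B).comp
    ((ContinuousLinearMap.proj (R := ℝ) (φ := fun _ : Fin k => ℝ) i).compLpL 1 μ01)

lemma PhiF_apply {k : ℕ} (B : L1 →L[ℝ] ell1 k) (H : Lp (Fin k → ℝ) 1 μ01) :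
    PhiF B H = ∑ i, (B ((ContinuousLinearMap.proj (R := ℝ)
      (φ := fun _ : Fin k => ℝ) i).compLp H)) i := by
  simp [PhiF]
  rfl

lemma PhiF_bound {k : ℕ} (B : L1 →L[ℝ] ell1 k) (H : Lp (Fin k → ℝ) 1 μ01) :
    |PhiF B H| ≤ ‖B‖ * ‖H‖ := by
  refine Lp.induction (p := 1) (by simp) (fun H => |PhiF B H| ≤ ‖B‖ * ‖H‖) ?_ ?_ ?_ H
  · intro c s hs hμ
    rw [Lp.simpleFunc.coe_indicatorConst]
    set u : L1 := indicatorConstLp 1 hs hμ.ne (1:ℝ) with hu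
    have hc : ∀ i, (ContinuousLinearMap.proj (R := ℝ) (φ := fun _ : Fin k => ℝ) i).compLp
        (indicatorConstLp 1 hs hμ.ne c : Lp (Fin k → ℝ) 1 μ01) = c i • u := by
      intro i
      apply Lp.ext
      filter_upwards [ContinuousLinearMap.coeFn_compLp
        (ContinuousLinearMap.proj (R := ℝ) (φ := fun _ : Fin k => ℝ) i)
        (indicatorConstLp 1 hs hμ.ne c : Lp (Fin k → ℝ) 1 μ01),
        indicatorConstLp_coeFn (p := 1) (hs := hs) (hμs := hμ.ne) (c := c) (μ := μ01),
        indicatorConstLp_coeFn (p := 1) (hs := hs) (hμs := hμ.ne) (c := (1:ℝ)) (μ := μ01),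
        Lp.coeFn_smul (c i) u] with x h1 h2 h3 h4
      rw [h1, h4, h2, Pi.smul_apply, hu, h3]
      by_cases hx : x ∈ s <;> simp [hx]
    rw [PhiF_apply]
    simp only [hc, map_smul]
    have hn : ‖(indicatorConstLp 1 hs hμ.ne c : Lp (Fin k → ℝ) 1 μ01)‖ = ‖c‖ * ‖u‖ := by
      rw [hu, norm_indicatorConstLp (by simp) (by simp),
        norm_indicatorConstLp (by simp) (by simp)]
      simp
    rw [hn]
    calc |∑ i, (c i • B u) i| ≤ ∑ i, |(c i • B u) i| := Finset.abs_sum_le_sum_abs _ _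
      _ ≤ ∑ i, ‖c‖ * ‖(B u) i‖ := by
        apply Finset.sum_le_sum
        intro i _
        simp only [PiLp.smul_apply, smul_eq_mul, abs_mul]
        exact mul_le_mul_of_nonneg_right (norm_le_pi_norm c i) (abs_nonneg _)
      _ = ‖c‖ * ‖B u‖ := by rw [← Finset.mul_sum, PiLp.norm_eq_of_L1]
      _ ≤ ‖c‖ * (‖B‖ * ‖u‖) := by gcongr; exact B.le_opNorm u
      _ = _ := by ring
  · intro f g hf hg hd h1 h2
    rw [map_add]
    have : ‖hf.toLp f + hg.toLp g‖ = ‖hf.toLp f‖ + ‖hg.toLp g‖ := by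
      rw [← MemLp.toLp_add]
      have hf' := memLp_one_iff_integrable.1 hf
      have hg' := memLp_one_iff_integrable.1 hg
      have e : ∀ (f : ℝ → Fin k → ℝ) (hf : MemLp f 1 μ01),
          ‖hf.toLp f‖ = ∫ x, ‖f x‖ ∂μ01 := by
        intro f hf
        rw [L1.norm_eq_integral_norm]
        apply integral_congr_ae
        filter_upwards [hf.coeFn_toLp] with x hx
        rw [hx]
      rw [e, e, e, ← integral_add hf'.norm hg'.norm]
      apply integral_congr_ae
      refine Filter.Eventually.of_forall fun x => ?_
      by_cases hx : f x = 0
      · simp [hx]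
      · have : g x = 0 := by
          by_contra hgx
          exact Set.disjoint_left.1 hd (Function.mem_support.2 hx) (Function.mem_support.2 hgx)
        simp [this]
    rw [this, mul_add]
    exact (abs_add_le _ _).trans (add_le_add h1 h2)
  · exact isClosed_le (by fun_prop) (by fun_prop)

lemma key {k : ℕ} (B : L1 →L[ℝ] ell1 k) (g : L1) (h : Fin k → L1) (hh : ∀ i, |h i| ≤ g) :
    |∑ i, (B (h i)) i| ≤ ‖B‖ * ‖g‖ := by
  have hm : MemLp (fun x i => h i x) 1 μ01 := by
    rw [memLp_one_iff_integrable]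
    exact Integrable.of_eval fun i => L1.integrable_coeFn (h i)
  have e : ∀ i, (ContinuousLinearMap.proj (R := ℝ) (φ := fun _ : Fin k => ℝ) i).compLp
      (hm.toLp) = h i := by
    intro i
    apply Lp.ext
    filter_upwards [ContinuousLinearMap.coeFn_compLp
        (ContinuousLinearMap.proj (R := ℝ) (φ := fun _ : Fin k => ℝ) i) hm.toLp,
        hm.coeFn_toLp] with x h1 h2
    rw [h1, h2]
    rfl
  have := PhiF_bound B hm.toLp
  rw [PhiF_apply] at this
  simp only [e] at this
  refine this.trans (mul_le_mul_of_nonneg_left ?_ (norm_nonneg _))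
  apply Lp.norm_le_norm_of_ae_le
  have hall : ∀ᵐ x ∂μ01, ∀ i, |h i x| ≤ g x := by
    rw [ae_all_iff]
    intro i
    filter_upwards [Lp.coeFn_le _ _ |>.2 (hh i), Lp.coeFn_abs (h i)] with x h1 h2
    rwa [← h2]
  filter_upwards [hall, hm.coeFn_toLp] with x h1 h2
  rw [h2, pi_norm_le_iff_of_nonneg (norm_nonneg _)]
  intro i
  exact (h1 i).trans (le_abs_self _)

lemma trunc (f g : L1) (hg : 0 ≤ g) :
    ∃ h : L1, |h| ≤ g ∧ ‖f - h‖ ≤ ‖(|f| - g) ⊔ 0‖ := by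
  refine ⟨(f ⊓ g) ⊔ (-g), ?_, ?_⟩
  · rw [abs_le']
    refine ⟨sup_le inf_le_right ((neg_nonpos.2 hg).trans hg), ?_⟩
    rw [neg_le]; exact le_sup_right
  · apply Lp.norm_le_norm_of_ae_le
    filter_upwards [Lp.coeFn_sub f ((f ⊓ g) ⊔ (-g)), Lp.coeFn_sup (f ⊓ g) (-g),
      Lp.coeFn_inf f g, Lp.coeFn_neg g, Lp.coeFn_sup (|f| - g) 0, Lp.coeFn_sub |f| g,
      Lp.coeFn_abs f, Lp.coeFn_zero ℝ 1 μ01, (Lp.coeFn_nonneg _).2 hg]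
      with x h1 h2 h3 h4 h5 h6 h7 h8 h9
    rw [h1, h5, Pi.sub_apply, h2, Pi.sup_apply, Pi.sup_apply, h3, h4, h6, h8, Pi.inf_apply,
      Pi.neg_apply, Pi.sub_apply, h7]
    simp only [Pi.zero_apply] at h9 ⊢
    generalize f x = a at *
    generalize g x = b at *
    rw [Real.norm_eq_abs, Real.norm_eq_abs]
    grind

/-- **The dichotomy is genuine.** If the identity operators on `ℓ₁ᵏ` (`k ∈ ℕ`) uniformly
factor through a uniformly bounded sequence of operators `T_m : X_m → L¹` from Banach
spaces, then the `T_m` do not have uniform approximate lattice bounds. -/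
theorem dichotomy_not_both {X : ℕ → Type*} [∀ m, NormedAddCommGroup (X m)]
    [∀ m, NormedSpace ℝ (X m)] [∀ m, CompleteSpace (X m)]
    (T : ∀ m, X m →L[ℝ] L1) (hT : ∃ M : ℝ, ∀ m, ‖T m‖ ≤ M)
    (hfac : ∃ C : ℝ, 0 < C ∧ ∀ k : ℕ, ∃ m : ℕ, ∃ A : ell1 k →L[ℝ] X m, ∃ B : L1 →L[ℝ] ell1 k,
      B.comp ((T m).comp A) = ContinuousLinearMap.id ℝ (ell1 k) ∧ ‖A‖ * ‖B‖ ≤ C) :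
    ¬ UniformApproxLatticeBounds T := by
  intro hU
  obtain ⟨C, hC, hfac⟩ := hfac
  obtain ⟨D, hD, hU⟩ := hU (1 / (2 * C)) (by positivity)
  obtain ⟨k, hk⟩ := exists_nat_gt (2 * (C * D))
  obtain ⟨m, A, B, hid, hAB⟩ := hfac k
  obtain ⟨g, hg, hgD, hx⟩ := hU m
  have hk0 : 0 < k := by
    have : (0:ℝ) < k := lt_trans (by positivity) hk
    exact_mod_cast this
  let e : Fin k → ell1 k := fun i => PiLp.single 1 i (1:ℝ)
  have he : ∀ i, ‖e i‖ = 1 := fun i => by simp [e]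
  have hBe : ∀ i, B (T m (A (e i))) = e i := fun i => DFunLike.congr_fun hid (e i)
  have hA : 0 < ‖A‖ := by
    rw [norm_pos_iff]
    rintro rfl
    have h1 := hBe ⟨0, hk0⟩
    have h2 := he ⟨0, hk0⟩
    rw [← h1] at h2
    simp at h2
  let f : Fin k → L1 := fun i => T m (‖A‖⁻¹ • A (e i))
  have hf : ∀ i, ‖(|f i| - g) ⊔ 0‖ ≤ 1 / (2 * C) := by
    intro i
    apply hx
    rw [norm_smul, norm_inv, norm_norm]
    have := A.le_opNorm (e i)
    rw [he, mul_one] at this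
    rw [inv_mul_le_iff₀ hA]; simpa using this
  choose h hh1 hh2 using fun i => trunc (f i) g hg
  have hkey := key B g h hh1
  have hlow : ∀ i, ‖A‖⁻¹ - ‖B‖ * (1 / (2 * C)) ≤ (B (h i)) i := by
    intro i
    have h1 : (B (f i)) i = ‖A‖⁻¹ := by
      simp only [f, map_smul, hBe]
      simp [e]
    have h2 : |(B (f i - h i)) i| ≤ ‖B‖ * (1 / (2 * C)) := by
      calc |(B (f i - h i)) i| ≤ ‖B (f i - h i)‖ := by
            rw [← Real.norm_eq_abs]; exact PiLp.norm_apply_le (B (f i - h i)) i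
        _ ≤ ‖B‖ * ‖f i - h i‖ := B.le_opNorm _
        _ ≤ _ := by gcongr; exact (hh2 i).trans (hf i)
    rw [map_sub, PiLp.sub_apply, h1] at h2
    linarith [(abs_le.1 h2).2]
  have hsum : (k:ℝ) * (‖A‖⁻¹ - ‖B‖ * (1 / (2 * C))) ≤ ‖B‖ * D := by
    calc (k:ℝ) * (‖A‖⁻¹ - ‖B‖ * (1 / (2 * C)))
        = ∑ i : Fin k, (‖A‖⁻¹ - ‖B‖ * (1 / (2 * C))) := by simp [mul_sub]
      _ ≤ ∑ i, (B (h i)) i := Finset.sum_le_sum fun i _ => hlow i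
      _ ≤ ‖B‖ * ‖g‖ := (le_abs_self _).trans hkey
      _ ≤ _ := by gcongr
  have h3 := mul_le_mul_of_nonneg_left hsum hA.le
  have h4 : ‖A‖ * ((k:ℝ) * (‖A‖⁻¹ - ‖B‖ * (1 / (2 * C))))
      = k * (1 - (‖A‖ * ‖B‖) * (1 / (2 * C))) := by
    field_simp
  have h5 : (‖A‖ * ‖B‖) * (1 / (2 * C)) ≤ 1 / 2 := by
    calc (‖A‖ * ‖B‖) * (1 / (2 * C)) ≤ C * (1 / (2 * C)) := by gcongr
      _ = 1 / 2 := by field_simp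
  have h6 : ‖A‖ * (‖B‖ * D) ≤ C * D := by
    rw [← mul_assoc]; gcongr
  have h7 : (k:ℝ) * (1 / 2) ≤ k * (1 - (‖A‖ * ‖B‖) * (1 / (2 * C))) := by
    gcongr; linarith
  linarith

end
end

section
/- Let T_m : X_m → L¹ (m ∈ ℕ) be a uniformly bounded sequence of operators from Banach spaces X_m. If the T_m have uniform lattice bounds, i.e. there exist C > 0 and, for each m, g_m ∈ L¹ with ‖g_m‖₁ ≤ C and |T_m x| ≤ g_m for all x in the closed unit ball of X_m, then the T_m uniformly factor through L∞[0,1]: there exists C' > 0 such that for each m there are bounded operators A_m : X_m → L∞[0,1] and B_m : L∞[0,1] → L¹ with T_m = B_m ∘ A_m and ‖A_m‖·‖B_m‖ ≤ C'. -/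
open MeasureTheory

noncomputable section

/-- The space `L∞[0,1]`. -/
abbrev Linf : Type := Lp ℝ ⊤ μ01

lemma lattice_bound_all {Y : Type*} [NormedAddCommGroup Y] [NormedSpace ℝ Y]
    (T : Y →L[ℝ] L1) (g : L1) (hbd : ∀ x : Y, ‖x‖ ≤ 1 → |T x| ≤ g) (x : Y) :
    ∀ᵐ t ∂μ01, |T x t| ≤ ‖x‖ * g t := by
  by_cases hx : x = 0
  · subst hx
    have h0 : T 0 = 0 := map_zero T
    rw [h0]
    filter_upwards [Lp.coeFn_zero ℝ 1 μ01] with t ht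
    rw [ht]
    simp
  · have hn : 0 < ‖x‖ := norm_pos_iff.mpr hx
    have h1 : ‖(‖x‖⁻¹ : ℝ) • x‖ ≤ 1 := by
      rw [norm_smul, norm_inv, norm_norm, inv_mul_cancel₀ hn.ne']
    have h2 := hbd _ h1
    rw [map_smul] at h2
    have h3 := (Lp.coeFn_le _ _).mpr h2
    filter_upwards [h3, Lp.coeFn_abs ((‖x‖⁻¹ : ℝ) • T x), Lp.coeFn_smul (‖x‖⁻¹ : ℝ) (T x)]
      with t a b c
    rw [b, c, Pi.smul_apply, smul_eq_mul, abs_mul, abs_of_pos (inv_pos.mpr hn)] at a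
    rwa [inv_mul_le_iff₀ hn] at a

lemma factor_one {Y : Type*} [NormedAddCommGroup Y] [NormedSpace ℝ Y]
    (T : Y →L[ℝ] L1) (g : L1) (hbd : ∀ x : Y, ‖x‖ ≤ 1 → |T x| ≤ g) :
    ∃ A : Y →L[ℝ] Linf, ∃ B : Linf →L[ℝ] L1,
      T = B.comp A ∧ ‖A‖ * ‖B‖ ≤ ‖g‖ := by
  have hall := lattice_bound_all T g hbd
  have hb : ∀ x : Y, ∀ᵐ t ∂μ01, ‖T x t / g t‖ ≤ ‖x‖ := by
    intro x
    filter_upwards [hall x] with t ht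
    rw [norm_div, Real.norm_eq_abs, Real.norm_eq_abs]
    apply div_le_of_le_mul₀ (abs_nonneg _) (norm_nonneg _)
    exact ht.trans (mul_le_mul_of_nonneg_left (le_abs_self _) (norm_nonneg _))
  have hmem : ∀ x : Y, MemLp (fun t => T x t / g t) ⊤ μ01 := fun x =>
    memLp_top_of_bound ((Lp.aestronglyMeasurable (T x)).aemeasurable.div
      (Lp.aestronglyMeasurable g).aemeasurable).aestronglyMeasurable ‖x‖ (hb x)
  let A₀ : Y →ₗ[ℝ] Linf :=
    { toFun := fun x => (hmem x).toLp _
      map_add' := by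
        intro x y
        apply Lp.ext
        have h := Lp.coeFn_add (T x) (T y)
        rw [← map_add] at h
        filter_upwards [(hmem (x + y)).coeFn_toLp, (hmem x).coeFn_toLp, (hmem y).coeFn_toLp,
          Lp.coeFn_add ((hmem x).toLp _) ((hmem y).toLp _), h] with t a b c d e
        rw [a, d, Pi.add_apply, b, c, e, Pi.add_apply, add_div]
      map_smul' := by
        intro r x
        apply Lp.ext
        have h := Lp.coeFn_smul r (T x)
        rw [← map_smul] at h
        filter_upwards [(hmem (r • x)).coeFn_toLp, (hmem x).coeFn_toLp,
          Lp.coeFn_smul r ((hmem x).toLp _), h] with t a b d e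
        simp only [RingHom.id_apply]
        rw [a, d, Pi.smul_apply, b, e, Pi.smul_apply, smul_eq_mul, smul_eq_mul, mul_div_assoc] }
  have hA₀ : ∀ x, ‖A₀ x‖ ≤ 1 * ‖x‖ := by
    intro x
    rw [one_mul]
    have := Lp.norm_le_of_ae_bound (f := A₀ x) (C := ‖x‖) (norm_nonneg x) (by
      filter_upwards [(hmem x).coeFn_toLp, hb x] with t a b
      change ‖((hmem x).toLp _ : Linf) t‖ ≤ _
      rw [a]; exact b)
    simpa using this
  let M := (ContinuousLinearMap.mul ℝ ℝ).holderL μ01 1 ⊤ 1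
  refine ⟨A₀.mkContinuous 1 hA₀, M g, ?_, ?_⟩
  · ext1 x
    apply Lp.ext
    have h := (ContinuousLinearMap.mul ℝ ℝ).coeFn_holder (r := 1) g ((hmem x).toLp _)
    filter_upwards [h, (hmem x).coeFn_toLp, hall x] with t a b c
    change _ = ((ContinuousLinearMap.mul ℝ ℝ).holder 1 g ((hmem x).toLp _) : L1) t
    rw [a, b, ContinuousLinearMap.mul_apply']
    by_cases hg : g t = 0
    · rw [hg, mul_zero] at c
      rw [hg, zero_mul]
      exact abs_nonpos_iff.mp c
    · field_simp
  · have h1 : ‖A₀.mkContinuous 1 hA₀‖ ≤ 1 := A₀.mkContinuous_norm_le zero_le_one hA₀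
    have h2 : ‖M‖ ≤ 1 :=
      ((ContinuousLinearMap.mul ℝ ℝ).norm_holderL_le).trans
        (ContinuousLinearMap.opNorm_mul_le ℝ ℝ)
    have h3 : ‖M g‖ ≤ ‖g‖ := by
      simpa using M.le_of_opNorm_le h2 g
    calc _ ≤ 1 * ‖g‖ := mul_le_mul h1 h3 (norm_nonneg _) zero_le_one
      _ = ‖g‖ := one_mul _

/-- **Uniform lattice bounds give uniform factorization through `L∞`.** If a uniformly
bounded sequence of operators `T_m : X_m → L¹` admits lattice bounds `g_m` with
`‖g_m‖₁ ≤ C` and `|T_m x| ≤ g_m` on the unit ball, then the `T_m` uniformly factor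
through `L∞[0,1]`. -/
theorem uniform_lattice_bounds_factor_Linf {X : ℕ → Type*} [∀ m, NormedAddCommGroup (X m)]
    [∀ m, NormedSpace ℝ (X m)] [∀ m, CompleteSpace (X m)]
    (T : ∀ m, X m →L[ℝ] L1) (hT : ∃ M : ℝ, ∀ m, ‖T m‖ ≤ M)
    (C : ℝ) (hC : 0 < C) (g : ∀ _ : ℕ, L1) (hgC : ∀ m, ‖g m‖ ≤ C)
    (hbd : ∀ m, ∀ x : X m, ‖x‖ ≤ 1 → |T m x| ≤ g m) :
    ∃ C' : ℝ, 0 < C' ∧ ∀ m, ∃ A : X m →L[ℝ] Linf, ∃ B : Linf →L[ℝ] L1,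
      T m = B.comp A ∧ ‖A‖ * ‖B‖ ≤ C' := by
  refine ⟨C, hC, fun m => ?_⟩
  obtain ⟨A, B, h, hn⟩ := factor_one (T m) (g m) (hbd m)
  exact ⟨A, B, h, hn.trans (hgC m)⟩

end
end

section
/- For each m ∈ ℕ let N_m ∈ ℕ and let T_m : ℓ₁^{N_m} → L¹ be bounded operators with sup_m ‖T_m‖ < ∞. If the T_m have uniform approximate lattice bounds, then the T_m uniformly approximately factor through the spaces ℓ∞ⁿ (n ∈ ℕ): for every ε > 0 there exists C > 0 such that for each m there are n ∈ ℕ and bounded operators A_m : ℓ₁^{N_m} → ℓ∞ⁿ, B_m : ℓ∞ⁿ → L¹ with ‖T_m − B_m ∘ A_m‖ < ε and ‖A_m‖·‖B_m‖ ≤ C. -/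
open MeasureTheory

noncomputable section

/-- `ℓ∞ⁿ`, i.e. `ℝⁿ` with the norm `max |aᵢ|`. -/
abbrev ellInf (n : ℕ) : Type := PiLp ⊤ (fun _ : Fin n => ℝ)

theorem aux_clamp (a g : ℝ) (hg : 0 ≤ g) :
    |a - g * max (-1) (min 1 (a / g))| ≤ max (|a| - g) 0 := by
  rcases hg.eq_or_lt with h | h
  · subst h; simp
  · obtain ⟨t, rfl⟩ : ∃ t, a = g * t := ⟨a / g, by field_simp⟩
    rw [mul_div_cancel_left₀ _ h.ne', ← mul_sub, abs_mul, abs_mul, abs_of_pos h]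
    have : |t - max (-1) (min 1 t)| ≤ max (|t| - 1) 0 := by
      rcases le_total 1 t with h1 | h1
      · rw [min_eq_left h1, max_eq_right (by norm_num), abs_of_nonneg (by linarith),
          abs_of_nonneg (by linarith)]
        exact le_max_left _ _
      · rw [min_eq_right h1]
        rcases le_total (-1) t with h2 | h2
        · rw [max_eq_right h2]; simp
        · rw [max_eq_left h2, abs_of_nonpos (by linarith), abs_of_nonpos (by linarith)]
          exact le_trans (by linarith) (le_max_left _ _)
    calc g * |t - max (-1) (min 1 t)| ≤ g * max (|t| - 1) 0 :=
          mul_le_mul_of_nonneg_left this h.le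
      _ = max (g * |t| - g) 0 := by
          rw [mul_max_of_nonneg _ _ h.le]; ring_nf

/-- The multiplication operator `b ↦ g · (b ∘ idx)`. -/
theorem aux_B (n : ℕ) (g : L1) (idx : ℝ → Fin n) (hidx : Measurable idx) :
    ∃ B : ellInf n →L[ℝ] L1, ‖B‖ ≤ ‖g‖ ∧
      ∀ b, ∀ᵐ x ∂μ01, B b x = g x * b (idx x) := by
  have key : ∀ b : ellInf n, MemLp (fun x => g x * b (idx x)) 1 μ01 := by
    intro b
    have hb : Measurable fun x => b (idx x) :=
      (measurable_of_finite (fun j => b j)).comp hidx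
    refine MemLp.of_le_mul (c := ‖b‖) (Lp.memLp g)
      ((Lp.aestronglyMeasurable g).mul hb.aestronglyMeasurable) ?_
    filter_upwards with x
    rw [norm_mul, mul_comm]
    exact mul_le_mul_of_nonneg_right (PiLp.norm_apply_le b _) (norm_nonneg _)
  let L : ellInf n →ₗ[ℝ] L1 :=
    { toFun := fun b => (key b).toLp _
      map_add' := by
        intro b c
        rw [← MemLp.toLp_add]
        congr 1
        ext x
        simp [mul_add]
      map_smul' := by
        intro r b
        rw [RingHom.id_apply, ← MemLp.toLp_const_smul]
        congr 1
        ext x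
        simp only [PiLp.smul_apply, Pi.smul_apply, smul_eq_mul]
        ring }
  have hL : ∀ b, ∀ᵐ x ∂μ01, L b x = g x * b (idx x) := fun b => (key b).coeFn_toLp
  refine ⟨L.mkContinuous ‖g‖ ?_, L.mkContinuous_norm_le (norm_nonneg _) _, hL⟩
  intro b
  rw [mul_comm]
  refine Lp.norm_le_mul_norm_of_ae_le_mul ?_
  filter_upwards [hL b] with x hx
  rw [hx, norm_mul, mul_comm]
  exact mul_le_mul_of_nonneg_right (PiLp.norm_apply_le b _) (norm_nonneg _)

theorem aux_A (k n : ℕ) (v : Fin n → Fin k → ℝ) (hv : ∀ j i, |v j i| ≤ 1) :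
    ∃ A : ell1 k →L[ℝ] ellInf n, ‖A‖ ≤ 1 ∧ ∀ x j, A x j = ∑ i, x i * v j i := by
  let L : ell1 k →ₗ[ℝ] ellInf n :=
    { toFun := fun x => WithLp.toLp ⊤ fun j => ∑ i, x i * v j i
      map_add' := by
        intro x y
        ext j
        simp [add_mul, Finset.sum_add_distrib]
      map_smul' := by
        intro r x
        ext j
        simp [Finset.mul_sum, mul_assoc] }
  refine ⟨L.mkContinuous 1 ?_, L.mkContinuous_norm_le zero_le_one _, fun x j => rfl⟩
  intro x
  rw [one_mul, PiLp.norm_eq_of_L1]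
  rw [PiLp.norm_eq_ciSup]
  refine Real.iSup_le (fun j => ?_) (Finset.sum_nonneg fun i _ => norm_nonneg _)
  change ‖∑ i, x i * v j i‖ ≤ _
  refine (norm_sum_le _ _).trans (Finset.sum_le_sum fun i _ => ?_)
  rw [norm_mul]
  exact mul_le_of_le_one_right (norm_nonneg _) (hv j i)

theorem aux_opNorm (k : ℕ) (S : ell1 k →L[ℝ] L1) (δ : ℝ) (hδ : 0 ≤ δ)
    (h : ∀ i, ‖S (PiLp.single 1 i 1)‖ ≤ δ) : ‖S‖ ≤ δ := by
  refine S.opNorm_le_bound hδ fun x => ?_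
  have hx : x = ∑ i, x i • (PiLp.single 1 i (1 : ℝ) : ell1 k) := by
    ext j
    simp [Pi.single_apply]
  conv_lhs => rw [hx]
  rw [map_sum, PiLp.norm_eq_of_L1, Finset.mul_sum]
  refine (norm_sum_le _ _).trans (Finset.sum_le_sum fun i _ => ?_)
  rw [map_smul, norm_smul, mul_comm]
  exact mul_le_mul_of_nonneg_right (h i) (norm_nonneg _)

/-- A measurable family with values in `[-1,1]` is uniformly close to a finite-valued one. -/
theorem aux_round (k K : ℕ) (hK : 0 < K) (u : Fin k → ℝ → ℝ) (hu : ∀ i, Measurable (u i))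
    (hb : ∀ i x, |u i x| ≤ 1) :
    ∃ n : ℕ, ∃ idx : ℝ → Fin n, Measurable idx ∧ ∃ v : Fin n → Fin k → ℝ,
      (∀ j i, |v j i| ≤ 1) ∧ ∀ i x, |u i x - v (idx x) i| ≤ 1 / K := by
  have hK' : (0 : ℝ) < K := by exact_mod_cast hK
  let J := Fin k → Set.Icc (-(K : ℤ)) K
  let e : J ≃ Fin (Fintype.card J) := Fintype.equivFin J
  have hmem : ∀ i x, ⌊(K : ℝ) * u i x⌋ ∈ Set.Icc (-(K : ℤ)) K := by
    intro i x
    have h := abs_le.1 (hb i x)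
    constructor
    · rw [Int.le_floor]; push_cast; nlinarith
    · have h1 := Int.floor_le ((K : ℝ) * u i x)
      have : ((⌊(K : ℝ) * u i x⌋ : ℤ) : ℝ) ≤ ((K : ℤ) : ℝ) := by push_cast; nlinarith
      exact_mod_cast this
  let φ : ℝ → J := fun x i => ⟨⌊(K : ℝ) * u i x⌋, hmem i x⟩
  have hφ : Measurable φ := by
    refine measurable_pi_lambda _ fun i => Measurable.subtype_mk ?_
    exact ((hu i).const_mul _).floor
  refine ⟨Fintype.card J, fun x => e (φ x), (measurable_of_finite e).comp hφ,
    fun j i => ((e.symm j i : ℤ) : ℝ) / K, ?_, ?_⟩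
  · intro j i
    obtain ⟨h1, h2⟩ := (e.symm j i).2
    have h1' : (-(K : ℝ)) ≤ ((e.symm j i : ℤ) : ℝ) := by exact_mod_cast h1
    have h2' : ((e.symm j i : ℤ) : ℝ) ≤ K := by exact_mod_cast h2
    rw [abs_div, abs_of_pos hK', div_le_one hK']
    exact abs_le.2 ⟨h1', h2'⟩
  · intro i x
    simp only [Equiv.symm_apply_apply, φ]
    have h1 := Int.floor_le ((K : ℝ) * u i x)
    have h2 := Int.lt_floor_add_one ((K : ℝ) * u i x)
    have : u i x - (⌊(K : ℝ) * u i x⌋ : ℝ) / K = (K * u i x - (⌊(K : ℝ) * u i x⌋ : ℝ)) / K := by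
      field_simp
    rw [this, abs_div, abs_of_pos hK']
    apply div_le_div_of_nonneg_right _ hK'.le
    rw [abs_le]; constructor <;> linarith

theorem aux_single (k : ℕ) (T : ell1 k →L[ℝ] L1) (g : L1) (hg : 0 ≤ g) (δ : ℝ) (hδ : 0 ≤ δ)
    (h : ∀ x : ell1 k, ‖x‖ ≤ 1 → ‖(|T x| - g) ⊔ 0‖ ≤ δ) (K : ℕ) (hK : 0 < K) :
    ∃ n : ℕ, ∃ A : ell1 k →L[ℝ] ellInf n, ∃ B : ellInf n →L[ℝ] L1,
      ‖T - B.comp A‖ ≤ δ + 1 / K * ‖g‖ ∧ ‖A‖ ≤ 1 ∧ ‖B‖ ≤ ‖g‖ := by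
  let E : Fin k → ell1 k := fun i => PiLp.single 1 i 1
  let u : Fin k → ℝ → ℝ := fun i x => max (-1) (min 1 (T (E i) x / g x))
  have hu : ∀ i, Measurable (u i) := fun i =>
    measurable_const.max (measurable_const.min
      ((Lp.stronglyMeasurable (T (E i))).measurable.div (Lp.stronglyMeasurable g).measurable))
  have hb : ∀ i x, |u i x| ≤ 1 := fun i x =>
    abs_le.2 ⟨le_max_left _ _, max_le (by norm_num) (min_le_left _ _)⟩
  obtain ⟨n, idx, hidx, v, hv, huv⟩ := aux_round k K hK u hu hb
  obtain ⟨A, hA, hAx⟩ := aux_A k n v hv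
  obtain ⟨B, hB, hBx⟩ := aux_B n g idx hidx
  refine ⟨n, A, B, aux_opNorm k _ _ (by positivity) fun i => ?_, hA, hB⟩
  have hE : ‖E i‖ ≤ 1 := by simp [E]
  have hAE : ∀ j, A (E i) j = v j i := by
    intro j
    rw [hAx]
    simp [E, Pi.single_apply]
  have hmain : ‖(T - B.comp A) (E i)‖ ≤ ‖((|T (E i)| - g) ⊔ 0) + (1 / K : ℝ) • g‖ := by
    refine Lp.norm_le_norm_of_ae_le ?_
    have e0 : (T - B.comp A) (E i) = T (E i) - B (A (E i)) := rfl
    rw [e0]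
    filter_upwards [Lp.coeFn_sub (T (E i)) (B (A (E i))), hBx (A (E i)),
      Lp.coeFn_add ((|T (E i)| - g) ⊔ 0) ((1 / K : ℝ) • g),
      Lp.coeFn_smul (1 / K : ℝ) g, Lp.coeFn_sup (|T (E i)| - g) 0,
      Lp.coeFn_sub |T (E i)| g, Lp.coeFn_abs (T (E i)),
      Lp.coeFn_zero ℝ 1 μ01, (Lp.coeFn_nonneg g).2 hg] with x h1 h2 h3 h4 h5 h6 h7 h8 h9
    rw [h1, h3]
    simp only [Pi.sub_apply, Pi.add_apply]
    rw [h2, h4, h5, hAE]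
    simp only [Pi.sup_apply, Pi.smul_apply, smul_eq_mul]
    rw [h6, h8]
    simp only [Pi.sub_apply, Pi.zero_apply]
    rw [h7]
    have hgx : 0 ≤ g x := h9
    have c1 : |T (E i) x - g x * u i x| ≤ max (|T (E i) x| - g x) 0 :=
      aux_clamp _ _ hgx
    have c2 : |g x * u i x - g x * v (idx x) i| ≤ 1 / K * g x := by
      rw [← mul_sub, abs_mul, abs_of_nonneg hgx, mul_comm]
      exact mul_le_mul_of_nonneg_right (huv i x) hgx
    calc |T (E i) x - g x * v (idx x) i|
        ≤ |T (E i) x - g x * u i x| + |g x * u i x - g x * v (idx x) i| := abs_sub_le _ _ _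
      _ ≤ max (|T (E i) x| - g x) 0 + 1 / K * g x := add_le_add c1 c2
      _ ≤ _ := le_abs_self _
  refine hmain.trans ((norm_add_le _ _).trans (add_le_add (h _ hE) ?_))
  rw [norm_smul, Real.norm_of_nonneg (by positivity)]

/-- **Uniform approximate lattice bounds give uniform approximate factorization through
the `ℓ∞ⁿ` for operators defined on `ℓ₁`-spaces.** If a uniformly bounded sequence of
operators `T_m : ℓ₁^{N_m} → L¹` has uniform approximate lattice bounds, then the `T_m`
uniformly approximately factor through the spaces `ℓ∞ⁿ` (`n ∈ ℕ`). -/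
theorem approx_lattice_bounds_factor_ellInf (N : ℕ → ℕ)
    (T : ∀ m : ℕ, ell1 (N m) →L[ℝ] L1) (hT : ∃ M : ℝ, ∀ m, ‖T m‖ ≤ M)
    (hlat : ∀ ε : ℝ, 0 < ε → ∃ C : ℝ, 0 < C ∧ ∀ m : ℕ, ∃ g : L1, 0 ≤ g ∧ ‖g‖ ≤ C ∧
      ∀ x : ell1 (N m), ‖x‖ ≤ 1 → ‖(|T m x| - g) ⊔ 0‖ ≤ ε) :
    ∀ ε : ℝ, 0 < ε → ∃ C : ℝ, 0 < C ∧ ∀ m : ℕ, ∃ n : ℕ,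
      ∃ A : ell1 (N m) →L[ℝ] ellInf n, ∃ B : ellInf n →L[ℝ] L1,
        ‖T m - B.comp A‖ < ε ∧ ‖A‖ * ‖B‖ ≤ C := by
  intro ε hε
  obtain ⟨C, hC, hg⟩ := hlat (ε / 3) (by positivity)
  obtain ⟨K, hK⟩ := exists_nat_gt (3 * C / ε)
  have hK0 : (0 : ℝ) < K := lt_of_le_of_lt (by positivity) hK
  refine ⟨C, hC, fun m => ?_⟩
  obtain ⟨g, hg0, hgC, hx⟩ := hg m
  obtain ⟨n, A, B, h1, h2, h3⟩ := aux_single (N m) (T m) g hg0 (ε / 3) (by positivity) hx K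
    (by exact_mod_cast hK0)
  refine ⟨n, A, B, lt_of_le_of_lt h1 ?_, ?_⟩
  · have h4 : 1 / (K : ℝ) * ‖g‖ ≤ ε / 3 := by
      rw [div_lt_iff₀ hε] at hK
      rw [one_div, inv_mul_le_iff₀ hK0]
      linarith
    linarith
  · calc ‖A‖ * ‖B‖ ≤ 1 * ‖B‖ := mul_le_mul_of_nonneg_right h2 (norm_nonneg _)
      _ ≤ C := by linarith

end
end

section
/- Let δ ∈ (0,1] and k ∈ ℕ, and set n = ⌊10/δ⌋·k. If f_1,…,f_n ∈ L¹ satisfy ‖f_i‖₁ ≤ 1 for all i, and there are pairwise disjoint measurable sets E_1,…,E_n ⊆ [0,1] with ‖f_i·1_{E_i}‖₁ ≥ δ for all i, then there exist indices j_1 < j_2 < … < j_k such that ‖∑_{i=1}^k a_i f_{j_i}‖₁ ≥ δ/2 whenever ∑_{i=1}^k |a_i| = 1. In particular, (f_{j_i})_{i=1}^k is (2/δ)-equivalent to the unit vector basis of ℓ₁ᵏ. -/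
open MeasureTheory

noncomputable section

/-- Greedy deletion: a zero-diagonal weight matrix of bounded total weight has light principal
submatrices of every size. -/
lemma exists_light_subset {n : ℕ} (w : Fin n → Fin n → ℝ) (hd : ∀ i, w i i = 0)
    (hrow : ∀ i, ∑ j, w i j ≤ 1) (hn : 1 ≤ n) (d : ℕ) :
    ∀ s : ℕ, s + d = n → ∃ J : Finset (Fin n), J.card = s ∧
      (∑ i ∈ J, ∑ j ∈ J, w i j) * ((n : ℝ) - 1) ≤ (s : ℝ) * ((s : ℝ) - 1) := by
  have hn1 : (0 : ℝ) ≤ (n : ℝ) - 1 := by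
    have : (1 : ℝ) ≤ n := by exact_mod_cast hn
    linarith
  induction d with
  | zero =>
    intro s hs
    obtain rfl : s = n := by omega
    refine ⟨Finset.univ, by simp, ?_⟩
    have h : ∑ i, ∑ j, w i j ≤ (s : ℝ) := by
      calc ∑ i, ∑ j, w i j ≤ ∑ i : Fin s, (1 : ℝ) := Finset.sum_le_sum fun i _ => hrow i
        _ = s := by simp
    exact mul_le_mul_of_nonneg_right h hn1
  | succ d ih =>
    intro s hs
    obtain ⟨J, hJ, hW⟩ := ih (s + 1) (by omega)
    have hne : J.Nonempty := Finset.card_pos.mp (by omega)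
    set W := ∑ i ∈ J, ∑ j ∈ J, w i j with hWdef
    obtain ⟨v, hv, hvW⟩ : ∃ v ∈ J, 2 * W / (s + 1) ≤ (∑ j ∈ J, w v j) + ∑ i ∈ J, w i v := by
      apply Finset.exists_le_of_sum_le hne
      rw [Finset.sum_add_distrib, Finset.sum_comm (f := fun x i => w i x), ← hWdef,
        Finset.sum_const, hJ, nsmul_eq_mul]
      push_cast
      have : (s : ℝ) + 1 ≠ 0 := by positivity
      field_simp
      linarith
    refine ⟨J.erase v, by rw [Finset.card_erase_of_mem hv, hJ]; rfl, ?_⟩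
    have hE : ∑ i ∈ J.erase v, ∑ j ∈ J.erase v, w i j
        = W - ((∑ j ∈ J, w v j) + ∑ i ∈ J, w i v) := by
      have h1 : ∀ i, ∑ j ∈ J.erase v, w i j = ∑ j ∈ J, w i j - w i v := fun i => by
        rw [← Finset.sum_erase_add _ _ hv]; ring
      simp_rw [h1]
      rw [hWdef, ← Finset.sum_erase_add J (fun i => ∑ j ∈ J, w i j) hv,
        ← Finset.sum_erase_add J (fun i => w i v) hv, Finset.sum_sub_distrib, hd]
      ring
    rw [hE]
    push_cast at hW
    have hs1 : (0 : ℝ) < (s : ℝ) + 1 := by positivity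
    rcases Nat.eq_zero_or_pos s with h0 | hpos
    · subst h0
      rw [← hE]
      have : J.erase v = ∅ := by
        rw [← Finset.card_eq_zero, Finset.card_erase_of_mem hv, hJ]
      simp [this]
    · have hs' : (1 : ℝ) ≤ s := by exact_mod_cast hpos
      have h2 : W - ((∑ j ∈ J, w v j) + ∑ i ∈ J, w i v) ≤ W - 2 * W / (s + 1) := by linarith
      have h3 : W - 2 * W / (s + 1) = W * (((s : ℝ) - 1) / (s + 1)) := by
        field_simp; ring
      calc _ ≤ (W * (((s : ℝ) - 1) / (s + 1))) * ((n : ℝ) - 1) :=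
            mul_le_mul_of_nonneg_right (h2.trans h3.le) hn1
        _ = (W * ((n : ℝ) - 1)) * (((s : ℝ) - 1) / (s + 1)) := by ring
        _ ≤ ((s + 1) * (s + 1 - 1)) * (((s : ℝ) - 1) / (s + 1)) :=
            mul_le_mul_of_nonneg_right hW (div_nonneg (by linarith) hs1.le)
        _ = s * (s - 1) := by field_simp; ring

/-- Selection of the index set. -/
lemma exists_good_subset (δ : ℝ) (hδ0 : 0 < δ) (hδ1 : δ ≤ 1) (k n : ℕ)
    (hn : n = ⌊(10 : ℝ) / δ⌋₊ * k) (w : Fin n → Fin n → ℝ) (hw : ∀ i j, 0 ≤ w i j)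
    (hd : ∀ i, w i i = 0) (hrow : ∀ i, ∑ j, w i j ≤ 1) :
    ∃ J : Finset (Fin n), J.card = k ∧ ∀ i ∈ J, ∑ j ∈ J, w i j ≤ δ / 2 := by
  rcases Nat.eq_zero_or_pos k with h0 | hk
  · exact ⟨∅, by simp [h0], by simp⟩
  have hk1 : (1 : ℝ) ≤ k := by exact_mod_cast hk
  have h10 : 9 / δ ≤ (⌊(10 : ℝ) / δ⌋₊ : ℝ) := by
    have h1 := Nat.lt_floor_add_one ((10 : ℝ) / δ)
    have h2 : 1 ≤ 1 / δ := by rw [le_div_iff₀ hδ0]; linarith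
    have h3 : (10 : ℝ) / δ = 9 / δ + 1 / δ := by ring
    linarith
  have hnk : 9 * k ≤ (n : ℝ) * δ := by
    have h := (div_le_iff₀ hδ0).mp h10
    rw [hn]; push_cast
    nlinarith
  have hn9 : 9 * (k : ℝ) ≤ n := by
    have : (n : ℝ) * δ ≤ n * 1 := by gcongr
    linarith
  have hn9' : 9 * k ≤ n := by exact_mod_cast hn9
  obtain ⟨J, hJ, hW⟩ := exists_light_subset w hd hrow (by omega) (n - 2 * k) (2 * k) (by omega)
  classical
  set B := J.filter fun i => ¬ ∑ j ∈ J, w i j ≤ δ / 2 with hB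
  set G := J.filter fun i => ∑ j ∈ J, w i j ≤ δ / 2 with hG
  have hcard : G.card + B.card = 2 * k := by
    rw [← hJ]; exact Finset.card_filter_add_card_filter_not _
  have hBW : (B.card : ℝ) * (δ / 2) ≤ ∑ i ∈ J, ∑ j ∈ J, w i j := by
    calc (B.card : ℝ) * (δ / 2) = ∑ i ∈ B, δ / 2 := by simp
      _ ≤ ∑ i ∈ B, ∑ j ∈ J, w i j := Finset.sum_le_sum fun i hi => by
          rw [hB, Finset.mem_filter, not_le] at hi
          exact hi.2.le
      _ ≤ _ := Finset.sum_le_sum_of_subset_of_nonneg (Finset.filter_subset _ _)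
          fun i _ _ => Finset.sum_nonneg fun j _ => hw i j
  have hBk : B.card ≤ k := by
    by_contra hcon
    have hc : (k : ℝ) ≤ B.card := by exact_mod_cast (by omega : k ≤ B.card)
    push_cast at hW
    have hn1 : (0 : ℝ) ≤ (n : ℝ) - 1 := by linarith
    have h1 : (k * (δ / 2)) * ((n : ℝ) - 1) ≤ 2 * k * (2 * k - 1) :=
      (mul_le_mul_of_nonneg_right ((mul_le_mul_of_nonneg_right hc (by positivity)).trans hBW)
        hn1).trans hW
    have h2 : (k : ℝ) * ((δ / 2) * ((n : ℝ) - 1)) ≤ k * (2 * (2 * k - 1)) := by linarith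
    have h3 := le_of_mul_le_mul_left h2 (by linarith)
    nlinarith
  obtain ⟨K, hKG, hK⟩ := Finset.exists_subset_card_eq (by omega : k ≤ G.card)
  refine ⟨K, hK, fun i hi => ?_⟩
  have hiG := hKG hi
  rw [hG, Finset.mem_filter] at hiG
  refine le_trans ?_ hiG.2
  exact Finset.sum_le_sum_of_subset_of_nonneg (hKG.trans (Finset.filter_subset _ _))
    fun j _ _ => hw i j

lemma L1_integrable_abs (g : L1) : Integrable (fun t => |(g : ℝ → ℝ) t|) μ01 :=
  (L1.integrable_coeFn g).abs

/-- The seminorm of integration over a set. -/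
def locN (S : Set ℝ) (g : L1) : ℝ := ∫ t in S, |(g : ℝ → ℝ) t| ∂μ01

lemma locN_nonneg (S : Set ℝ) (g : L1) : 0 ≤ locN S g :=
  integral_nonneg fun _ => abs_nonneg _

lemma locN_add (S : Set ℝ) (g h : L1) : locN S (g + h) ≤ locN S g + locN S h := by
  unfold locN
  rw [← integral_add (L1_integrable_abs g).integrableOn (L1_integrable_abs h).integrableOn]
  refine integral_mono_ae (L1_integrable_abs _).integrableOn
    ((L1_integrable_abs g).integrableOn.add (L1_integrable_abs h).integrableOn) ?_
  filter_upwards [ae_restrict_of_ae (Lp.coeFn_add g h)] with t ht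
  rw [ht]
  exact abs_add_le _ _

lemma locN_smul (S : Set ℝ) (a : ℝ) (g : L1) : locN S (a • g) = |a| * locN S g := by
  unfold locN
  rw [← integral_const_mul]
  refine integral_congr_ae ?_
  filter_upwards [ae_restrict_of_ae (Lp.coeFn_smul a g)] with t ht
  rw [ht]
  simp [abs_mul]

lemma locN_zero (S : Set ℝ) : locN S 0 = 0 := by
  simpa using locN_smul S 0 0

lemma locN_sum {ι : Type*} (S : Set ℝ) (s : Finset ι) (g : ι → L1) :
    locN S (∑ i ∈ s, g i) ≤ ∑ i ∈ s, locN S (g i) :=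
  Finset.le_sum_of_subadditive _ (locN_zero S).le (locN_add S) s g

lemma sum_locN_le {ι : Type*} [Fintype ι] (E : ι → Set ℝ) (hE : ∀ i, MeasurableSet (E i))
    (hdisj : Pairwise (Function.onFun Disjoint E)) (g : L1) :
    ∑ i, locN (E i) g ≤ ‖g‖ := by
  unfold locN
  rw [← integral_iUnion_fintype hE hdisj fun i => (L1_integrable_abs g).integrableOn,
    L1.norm_eq_integral_norm]
  exact setIntegral_le_integral (L1_integrable_abs g) (Filter.Eventually.of_forall fun _ => abs_nonneg _)

lemma lower_bound (δ : ℝ) (k : ℕ) (f : Fin k → L1) (E : Fin k → Set ℝ)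
    (hE : ∀ i, MeasurableSet (E i)) (hdisj : Pairwise (Function.onFun Disjoint E))
    (hbig : ∀ i, δ ≤ locN (E i) (f i))
    (hsmall : ∀ i, ∑ j, (if i = j then 0 else locN (E j) (f i)) ≤ δ / 2) (a : Fin k → ℝ) :
    (δ / 2) * ∑ i, |a i| ≤ ‖∑ i, a i • f i‖ := by
  set g := ∑ i, a i • f i with hg
  have h1 : ∀ l, |a l| * δ ≤
      locN (E l) g + ∑ i, |a i| * (if i = l then 0 else locN (E l) (f i)) := by
    intro l
    have e1 : a l • f l = g + ∑ i, (if i = l then (0 : ℝ) else -a i) • f i := by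
      rw [hg, ← Finset.sum_add_distrib, Finset.sum_eq_single l]
      · simp
      · intro b _ hb
        simp [hb]
      · simp
    calc |a l| * δ ≤ |a l| * locN (E l) (f l) := by gcongr; exact hbig l
      _ = locN (E l) (a l • f l) := (locN_smul _ _ _).symm
      _ ≤ locN (E l) g + locN (E l) (∑ i, (if i = l then (0 : ℝ) else -a i) • f i) := by
          rw [e1]; exact locN_add _ _ _
      _ ≤ locN (E l) g + ∑ i, locN (E l) ((if i = l then (0 : ℝ) else -a i) • f i) := by
          gcongr; exact locN_sum _ _ _
      _ = _ := by
          congr 1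
          refine Finset.sum_congr rfl fun i _ => ?_
          rw [locN_smul]
          split_ifs <;> simp
  have h2 := Finset.sum_le_sum fun l (_ : l ∈ Finset.univ) => h1 l
  rw [Finset.sum_add_distrib, Finset.sum_comm, ← Finset.sum_mul] at h2
  simp_rw [← Finset.mul_sum] at h2
  have h3 : ∑ i, |a i| * ∑ l, (if i = l then 0 else locN (E l) (f i)) ≤ ∑ i, |a i| * (δ / 2) :=
    Finset.sum_le_sum fun i _ => mul_le_mul_of_nonneg_left (hsmall i) (abs_nonneg _)
  rw [← Finset.sum_mul] at h3
  have h4 := sum_locN_le E hE hdisj g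
  linarith

/-- **Rosenthal's subsequence theorem (quantitative form).** Let `δ ∈ (0,1]`, `k ∈ ℕ`,
`n = ⌊10/δ⌋·k`. If `f₁,…,f_n` are in the unit ball of `L¹` and there are pairwise disjoint
measurable sets `E₁,…,E_n ⊆ [0,1]` with `‖fᵢ·1_{Eᵢ}‖₁ ≥ δ`, then some subsequence
`(f_{j₁},…,f_{j_k})` (with `j₁ < ⋯ < j_k`) satisfies `‖∑ aᵢ f_{jᵢ}‖₁ ≥ δ/2` whenever
`∑|aᵢ| = 1`; in particular it is `2/δ`-equivalent to the unit vector basis of `ℓ₁ᵏ`. -/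
theorem rosenthal_subsequence (δ : ℝ) (hδ0 : 0 < δ) (hδ1 : δ ≤ 1) (k n : ℕ)
    (hn : n = ⌊(10 : ℝ) / δ⌋₊ * k)
    (f : Fin n → L1) (hf : ∀ i, ‖f i‖ ≤ 1)
    (E : Fin n → Set ℝ) (hEmeas : ∀ i, MeasurableSet (E i))
    (hEsub : ∀ i, E i ⊆ Set.Icc 0 1)
    (hdisj : Pairwise (Function.onFun Disjoint E))
    (hbig : ∀ i, δ ≤ ∫ t in E i, |(f i : ℝ → ℝ) t| ∂μ01) :
    ∃ j : Fin k → Fin n, StrictMono j ∧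
      (∀ a : Fin k → ℝ, (∑ i, |a i|) = 1 → δ / 2 ≤ ‖∑ i, a i • f (j i)‖) ∧
      (∀ a : Fin k → ℝ,
        (δ / 2) * ∑ i, |a i| ≤ ‖∑ i, a i • f (j i)‖ ∧ ‖∑ i, a i • f (j i)‖ ≤ ∑ i, |a i|) := by
  have hw : ∀ i l, 0 ≤ (if i = l then 0 else locN (E l) (f i)) := fun i l => by
    split_ifs
    · exact le_rfl
    · exact locN_nonneg _ _
  obtain ⟨J, hJ, hJs⟩ := exists_good_subset δ hδ0 hδ1 k n hn
    (fun i l => if i = l then 0 else locN (E l) (f i)) hw (by simp) (fun i => by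
      refine le_trans (Finset.sum_le_sum fun l _ => ?_)
        ((sum_locN_le E hEmeas hdisj (f i)).trans (hf i))
      split_ifs
      · exact locN_nonneg _ _
      · exact le_rfl)
  have key : ∀ a : Fin k → ℝ,
      (δ / 2) * ∑ i, |a i| ≤ ‖∑ i, a i • f (J.orderEmbOfFin hJ i)‖ := by
    refine lower_bound δ k (fun i => f (J.orderEmbOfFin hJ i)) (fun i => E (J.orderEmbOfFin hJ i))
      (fun i => hEmeas _) (fun x y hxy => hdisj ((J.orderEmbOfFin hJ).injective.ne hxy))
      (fun i => hbig _) (fun i => ?_)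
    refine le_trans (le_of_eq ?_) (hJs _ (J.orderEmbOfFin_mem hJ i))
    have hsum : ∀ F : Fin n → ℝ, ∑ l, F (J.orderEmbOfFin hJ l) = ∑ x ∈ J, F x := fun F => by
      have h := Finset.sum_map Finset.univ (J.orderEmbOfFin hJ).toEmbedding F
      rw [Finset.map_orderEmbOfFin_univ J hJ] at h
      exact h.symm
    rw [← hsum]
    refine Finset.sum_congr rfl fun l _ => ?_
    simp
  refine ⟨J.orderEmbOfFin hJ, (J.orderEmbOfFin hJ).strictMono, fun a ha => ?_, fun a => ⟨key a, ?_⟩⟩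
  · simpa [ha] using key a
  · refine (norm_sum_le _ _).trans (Finset.sum_le_sum fun i _ => ?_)
    rw [norm_smul, Real.norm_eq_abs]
    exact mul_le_of_le_one_right (abs_nonneg _) (hf _)

end
end

section
/- Let δ ∈ (0,1], k ∈ ℕ, and n = ⌊10/δ⌋·k. Let (α_{i,j})_{1≤i,j≤n} be a matrix of nonnegative reals with α_{i,i} = 0 for all i and with row sums ∑_{j=1}^n α_{i,j} ≤ 1 for every i. Then there exists a subset F ⊆ {1,…,n} with |F| = k such that ∑_{j∈F} α_{i,j} ≤ δ/2 for every i ∈ F. -/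
lemma exists_coloring {ι : Type*} [DecidableEq ι] (r : ℕ) (hr : 0 < r) (α : ι → ι → ℝ)
    (hdiag : ∀ i, α i i = 0) (S : Finset ι) :
    ∃ f : ι → Fin r, (r : ℝ) * ∑ i ∈ S, ∑ j ∈ S, (if f i = f j then α i j else 0)
      ≤ ∑ i ∈ S, ∑ j ∈ S, α i j := by
  induction S using Finset.induction_on with
  | empty => exact ⟨fun _ => ⟨0, hr⟩, by simp⟩
  | insert a S ha ih =>
    obtain ⟨f, hf⟩ := ih
    have : ∃ c ∈ (Finset.univ : Finset (Fin r)),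
        (r : ℝ) * ∑ j ∈ S, (if f j = c then α a j + α j a else 0)
          ≤ ∑ j ∈ S, (α a j + α j a) := by
      apply Finset.exists_le_of_sum_le
      · exact ⟨⟨0, hr⟩, Finset.mem_univ _⟩
      · rw [← Finset.mul_sum, Finset.sum_comm]
        simp
    obtain ⟨c, -, hc⟩ := this
    refine ⟨Function.update f a c, ?_⟩
    have hne : ∀ j ∈ S, Function.update f a c j = f j := fun j hj =>
      Function.update_of_ne (fun h : j = a => ha (h ▸ hj)) _ _
    have e1 : ∑ i ∈ S, ∑ j ∈ S, (if Function.update f a c i = Function.update f a c j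
        then α i j else 0) = ∑ i ∈ S, ∑ j ∈ S, (if f i = f j then α i j else 0) := by
      refine Finset.sum_congr rfl fun i hi => Finset.sum_congr rfl fun j hj => ?_
      rw [hne i hi, hne j hj]
    have e2 : ∑ j ∈ S, (if Function.update f a c a = Function.update f a c j
        then α a j else 0) + ∑ j ∈ S, (if Function.update f a c j = Function.update f a c a
        then α j a else 0) = ∑ j ∈ S, (if f j = c then α a j + α j a else 0) := by
      rw [← Finset.sum_add_distrib]
      refine Finset.sum_congr rfl fun j hj => ?_
      rw [hne j hj, Function.update_self]
      by_cases h : f j = c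
      · simp [h]
      · simp [h, Ne.symm h]
    simp only [Finset.sum_insert ha, Finset.sum_add_distrib, hdiag, ite_self] at *
    rw [e1]
    rw [← e2] at hc
    linarith


/-- **Combinatorial selection lemma.** Let `δ ∈ (0,1]`, `k ∈ ℕ` and `n = ⌊10/δ⌋·k`.
If `(α_{i,j})` is an `n × n` matrix of nonnegative reals with zero diagonal and all row sums
at most `1`, then there is a subset `F ⊆ {1,…,n}` of size `k` such that all row sums of the
submatrix `(α_{i,j})_{i,j ∈ F}` are at most `δ/2`. -/
theorem submatrix_small_row_sums (δ : ℝ) (hδ0 : 0 < δ) (hδ1 : δ ≤ 1) (k n : ℕ)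
    (hn : n = ⌊(10 : ℝ) / δ⌋₊ * k)
    (α : Fin n → Fin n → ℝ) (hnonneg : ∀ i j, 0 ≤ α i j) (hdiag : ∀ i, α i i = 0)
    (hrow : ∀ i, ∑ j, α i j ≤ 1) :
    ∃ F : Finset (Fin n), F.card = k ∧ ∀ i ∈ F, ∑ j ∈ F, α i j ≤ δ / 2 := by
  rcases Nat.eq_zero_or_pos k with hk | hk
  · exact ⟨∅, by simp [hk], by simp⟩
  set m := ⌊(10 : ℝ) / δ⌋₊ with hm
  have hm10 : 10 ≤ m := by
    apply Nat.le_floor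
    rw [le_div_iff₀ hδ0]
    push_cast
    linarith
  have hm1 : 10 < δ * (m + 1) := by
    have := Nat.lt_floor_add_one ((10 : ℝ) / δ)
    rw [div_lt_iff₀ hδ0] at this
    linarith
  obtain ⟨r, hr⟩ : ∃ r, r = m / 2 := ⟨_, rfl⟩
  have hr0 : 0 < r := by omega
  obtain ⟨f, hf⟩ := exists_coloring r hr0 α hdiag Finset.univ
  set R : Fin n → ℝ := fun i => ∑ j, (if f i = f j then α i j else 0) with hR
  have hR0 : ∀ i, 0 ≤ R i := fun i => Finset.sum_nonneg fun j _ => by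
    split_ifs
    · exact hnonneg i j
    · exact le_rfl
  have htot : ∑ i, ∑ j, α i j ≤ (n : ℝ) := by
    calc _ ≤ ∑ i : Fin n, (1 : ℝ) := Finset.sum_le_sum fun i _ => hrow i
      _ = n := by simp
  set G := Finset.univ.filter (fun i => R i ≤ δ / 2) with hG
  set B := Finset.univ.filter (fun i => ¬ R i ≤ δ / 2) with hB
  have hcard : G.card + B.card = n := by
    exact (Finset.card_filter_add_card_filter_not (s := Finset.univ)
      (fun i => R i ≤ δ / 2)).trans (by simp)
  have hbad : (B.card : ℝ) * (δ / 2) ≤ ∑ i, R i := by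
    calc (B.card : ℝ) * (δ / 2) = ∑ i ∈ B, δ / 2 := by simp
      _ ≤ ∑ i ∈ B, R i := Finset.sum_le_sum fun i hi => by
          simp only [hB, Finset.mem_filter] at hi
          exact (not_le.mp hi.2).le
      _ ≤ ∑ i, R i := Finset.sum_le_sum_of_subset_of_nonneg (Finset.subset_univ _)
          fun i _ _ => hR0 i
  have hrb : (r : ℝ) * (B.card * (δ / 2)) ≤ n :=
    (mul_le_mul_of_nonneg_left hbad (Nat.cast_nonneg r)).trans (hf.trans htot)
  have hb2 : (5 * r * B.card : ℝ) ≤ n * (m + 1) := by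
    have h1 : (r : ℝ) * (B.card * (δ / 2)) * (m + 1) ≤ n * (m + 1) :=
      mul_le_mul_of_nonneg_right hrb (by positivity)
    have h2 : (r * B.card : ℝ) * 10 ≤ (r * B.card : ℝ) * (δ * (m + 1)) :=
      mul_le_mul_of_nonneg_left hm1.le (by positivity)
    linarith
  have hb3 : 5 * r * B.card ≤ n * (m + 1) := by exact_mod_cast hb2
  have key : m * (m + 1) + 5 * r * r ≤ 5 * r * m := by
    obtain h | h : m = 2 * r ∨ m = 2 * r + 1 := by omega
    · have : 5 ≤ r := by omega
      rw [h]; nlinarith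
    · have : 5 ≤ r := by omega
      rw [h]; nlinarith
  have hgood : r * k ≤ G.card := by
    have h1 := Nat.mul_le_mul_right k key
    have h2 : 5 * r * (r * k) ≤ 5 * r * G.card := by
      have h3 : 5 * r * G.card + 5 * r * B.card = 5 * r * n := by
        rw [← mul_add, hcard]
      have h4 : n * (m + 1) = m * (m + 1) * k := by
        calc n * (m + 1) = (m * k) * (m + 1) := congrArg (· * (m + 1)) hn
          _ = _ := by ring
      have h5 : 5 * r * n = 5 * r * m * k := by
        calc 5 * r * n = 5 * r * (m * k) := congrArg (5 * r * ·) hn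
          _ = _ := by ring
      nlinarith
    exact Nat.le_of_mul_le_mul_left h2 (by omega)
  obtain ⟨c, -, hc⟩ := Finset.exists_le_card_fiber_of_mul_le_card_of_maps_to
    (s := G) (t := (Finset.univ : Finset (Fin r))) (f := f) (n := k)
    (fun _ _ => Finset.mem_univ _) ⟨⟨0, hr0⟩, Finset.mem_univ _⟩ (by simpa using hgood)
  obtain ⟨F, hF, hFk⟩ := Finset.exists_subset_card_eq hc
  refine ⟨F, hFk, fun i hi => ?_⟩
  have hi' := Finset.mem_filter.mp (hF hi)
  have hiG := (Finset.mem_filter.mp hi'.1).2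
  refine le_trans ?_ hiG
  calc ∑ j ∈ F, α i j = ∑ j ∈ F, (if f i = f j then α i j else 0) := by
        refine Finset.sum_congr rfl fun j hj => ?_
        rw [if_pos (hi'.2.trans (Finset.mem_filter.mp (hF hj)).2.symm)]
    _ ≤ R i := Finset.sum_le_sum_of_subset_of_nonneg (Finset.subset_univ _) fun j _ _ => by
        split_ifs
        · exact hnonneg i j
        · exact le_rfl
end

section
/- Let (X_m)_{m∈ℕ} be Banach spaces and T_m : X_m → L¹ bounded operators with ‖T_m‖ ≤ 1 for all m. Assume there exists δ > 0 such that for every n ∈ ℕ there exist m ∈ ℕ, elements x_1,…,x_n in the closed unit ball of X_m, and pairwise disjoint measurable sets E_1,…,E_n ⊆ [0,1] with ‖(T_m x_i)·1_{E_i}‖₁ ≥ δ for all i. Then the identity operators id_{ℓ₁ᵏ} (k ∈ ℕ) uniformly factor through the T_m: there exists C > 0 such that for every k there are m and bounded operators A : ℓ₁ᵏ → X_m, B : L¹ → ℓ₁ᵏ with B ∘ T_m ∘ A = id_{ℓ₁ᵏ} and ‖A‖·‖B‖ ≤ C. -/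
open MeasureTheory

noncomputable section

open Finset in
/-- Greedy extraction of an almost-orthogonal index set. -/
lemma greedy_aux {ι : Type*} [DecidableEq ι] (a : ι → ι → ℝ) (ha : ∀ i j, 0 ≤ a i j)
    (ε : ℝ) (hε : 0 < ε) (D : ℕ) (hD : 2 / ε + 1 ≤ D) (k : ℕ) :
    ∀ V : Finset ι, (∀ i, ∑ j ∈ V, a i j ≤ 1) → k * D ≤ V.card →
      ∃ S ⊆ V, S.card = k ∧ ∀ i ∈ S, ∀ j ∈ S, i ≠ j → a i j ≤ ε := by
  induction k with
  | zero => intro V _ _; exact ⟨∅, by simp, by simp, by simp⟩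
  | succ k ih =>
    intro V hV hc
    have hD1 : 1 ≤ D := by
      have : (1:ℝ) ≤ D := by
        have : 0 < 2 / ε := by positivity
        linarith
      exact_mod_cast this
    have hne : V.Nonempty := by
      rw [← Finset.card_pos]; nlinarith
    obtain ⟨v, hv, hcol⟩ : ∃ v ∈ V, ∑ i ∈ V, a i v ≤ 1 := by
      apply Finset.exists_le_of_sum_le hne
      rw [Finset.sum_comm]
      exact Finset.sum_le_sum fun i _ => hV i
    set V' := V.filter (fun w => w ≠ v ∧ a v w + a w v ≤ ε) with hV'
    set W := V.filter (fun w => ε < a v w + a w v) with hW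
    have hWc : (W.card : ℝ) * ε ≤ 2 := by
      calc (W.card : ℝ) * ε = ∑ w ∈ W, ε := by simp
        _ ≤ ∑ w ∈ W, (a v w + a w v) := Finset.sum_le_sum fun w hw => by
            rw [hW, Finset.mem_filter] at hw; exact hw.2.le
        _ ≤ ∑ w ∈ V, (a v w + a w v) :=
            Finset.sum_le_sum_of_subset_of_nonneg (Finset.filter_subset _ _)
              fun i _ _ => add_nonneg (ha _ _) (ha _ _)
        _ ≤ 2 := by rw [Finset.sum_add_distrib]; linarith [hV v]
    have hWD : W.card + 1 ≤ D := by
      have : (W.card : ℝ) + 1 ≤ D := by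
        have := (le_div_iff₀ hε).2 hWc
        linarith
      exact_mod_cast this
    have hsub : V ⊆ V' ∪ insert v W := by
      intro w hw
      simp only [hV', hW, Finset.mem_union, Finset.mem_insert, Finset.mem_filter, hw, true_and]
      by_cases h1 : w = v
      · simp [h1]
      · rcases le_or_gt (a v w + a w v) ε with h2 | h2 <;> simp [h1, h2]
    have hcard : V.card ≤ V'.card + (W.card + 1) :=
      (Finset.card_le_card hsub).trans ((Finset.card_union_le _ _).trans
        (Nat.add_le_add_left (Finset.card_insert_le _ _) _))
    obtain ⟨S, hS, hSc, hSp⟩ := ih V'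
      (fun i => (Finset.sum_le_sum_of_subset_of_nonneg (Finset.filter_subset _ _)
        fun j _ _ => ha i j).trans (hV i)) (by nlinarith)
    have hvS : v ∉ S := fun h => by
      have := hS h
      simp [hV'] at this
    have key : ∀ w ∈ S, a v w ≤ ε ∧ a w v ≤ ε := fun w hw => by
      have := hS hw
      rw [hV', Finset.mem_filter] at this
      exact ⟨by linarith [ha w v, this.2.2], by linarith [ha v w, this.2.2]⟩
    refine ⟨insert v S, ?_, ?_, ?_⟩
    · exact Finset.insert_subset hv (hS.trans (Finset.filter_subset _ _))
    · rw [Finset.card_insert_of_notMem hvS, hSc]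
    · intro i hi j hj hij
      rw [Finset.mem_insert] at hi hj
      rcases hi with rfl | hi <;> rcases hj with rfl | hj
      · exact absurd rfl hij
      · exact (key j hj).1
      · exact (key i hi).2
      · exact hSp i hi j hj hij

/-- A sign function. -/
def sgn (g : ℝ → ℝ) (t : ℝ) : ℝ := if 0 ≤ g t then 1 else -1

lemma sgn_mul (g : ℝ → ℝ) (t : ℝ) : sgn g t * g t = |g t| := by
  unfold sgn; split_ifs with h
  · rw [abs_of_nonneg h, one_mul]
  · rw [abs_of_neg (not_le.1 h)]; ring

lemma abs_sgn (g : ℝ → ℝ) (t : ℝ) : |sgn g t| = 1 := by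
  unfold sgn; split_ifs <;> simp

lemma measurable_sgn (g : ℝ → ℝ) (hg : Measurable g) : Measurable (sgn g) :=
  Measurable.ite (measurableSet_le measurable_const hg) measurable_const measurable_const

lemma L1_int (f : L1) : Integrable (f : ℝ → ℝ) μ01 := L1.integrable_coeFn f

lemma sgn_int (g : L1) (f : L1) : Integrable (fun t => sgn g t * f t) μ01 := by
  refine (L1_int f).bdd_mul (c := 1)
    (measurable_sgn _ (Lp.stronglyMeasurable g).measurable).aestronglyMeasurable ?_
  exact Filter.Eventually.of_forall fun t => (abs_sgn _ t).le

lemma sum_setInt_le {k : ℕ} (E : Fin k → Set ℝ) (hE : ∀ i, MeasurableSet (E i))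
    (hd : Pairwise (Function.onFun Disjoint E)) (f : L1) :
    ∑ i, ∫ t in E i, |(f : ℝ → ℝ) t| ∂μ01 ≤ ‖f‖ := by
  rw [L1.norm_eq_integral_norm]
  rw [← integral_iUnion_fintype hE hd (fun i => (L1_int f).abs.integrableOn)]
  exact setIntegral_le_integral (L1_int f).norm
    (Filter.Eventually.of_forall fun t => abs_nonneg _)

lemma abs_sgn_int_le (g f : L1) (E : Set ℝ) :
    |∫ t in E, sgn g t * f t ∂μ01| ≤ ∫ t in E, |(f : ℝ → ℝ) t| ∂μ01 := by
  refine abs_integral_le_integral_abs.trans (le_of_eq ?_)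
  congr 1; ext t; rw [abs_mul, abs_sgn, one_mul]

/-- The operator `f ↦ (∫_{E_j} sgn(g_j) f)_j`. -/
def B0 {k : ℕ} (E : Fin k → Set ℝ) (hE : ∀ i, MeasurableSet (E i))
    (hd : Pairwise (Function.onFun Disjoint E)) (g : Fin k → L1) : L1 →L[ℝ] ell1 k :=
  LinearMap.mkContinuous
    { toFun := fun f => WithLp.toLp 1 (fun j => ∫ t in E j, sgn (g j) t * f t ∂μ01)
      map_add' := by
        intro f f'
        ext j
        simp only [PiLp.add_apply]
        rw [← integral_add (sgn_int _ _).integrableOn (sgn_int _ _).integrableOn]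
        refine integral_congr_ae (ae_restrict_of_ae ?_)
        filter_upwards [Lp.coeFn_add f f'] with t ht
        rw [ht, Pi.add_apply, mul_add]
      map_smul' := by
        intro c f
        ext j
        simp only [PiLp.smul_apply, RingHom.id_apply, smul_eq_mul]
        rw [← integral_const_mul]
        refine integral_congr_ae (ae_restrict_of_ae ?_)
        filter_upwards [Lp.coeFn_smul c f] with t ht
        rw [ht, Pi.smul_apply, smul_eq_mul]; ring } 1 (by
    intro f
    rw [one_mul, PiLp.norm_eq_of_L1]
    refine le_trans (Finset.sum_le_sum fun j _ => ?_) (sum_setInt_le E hE hd f)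
    exact abs_sgn_int_le _ _ _)

lemma B0_apply {k : ℕ} (E : Fin k → Set ℝ) (hE : ∀ i, MeasurableSet (E i))
    (hd : Pairwise (Function.onFun Disjoint E)) (g : Fin k → L1) (f : L1) (j : Fin k) :
    B0 E hE hd g f j = ∫ t in E j, sgn (g j) t * f t ∂μ01 := rfl

lemma B0_norm {k : ℕ} (E : Fin k → Set ℝ) (hE : ∀ i, MeasurableSet (E i))
    (hd : Pairwise (Function.onFun Disjoint E)) (g : Fin k → L1) : ‖B0 E hE hd g‖ ≤ 1 :=
  LinearMap.mkContinuous_norm_le _ zero_le_one _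

/-- The operator `a ↦ ∑ a_i x_i`. -/
def A0 {X : Type*} [NormedAddCommGroup X] [NormedSpace ℝ X] {k : ℕ} (x : Fin k → X)
    (hx : ∀ i, ‖x i‖ ≤ 1) : ell1 k →L[ℝ] X :=
  LinearMap.mkContinuous
    { toFun := fun a => ∑ i, a i • x i
      map_add' := by intro a b; simp [add_smul, Finset.sum_add_distrib]
      map_smul' := by intro c a; simp [mul_smul, Finset.smul_sum] } 1 (by
    intro a
    rw [one_mul, PiLp.norm_eq_of_L1]
    change ‖∑ i, a i • x i‖ ≤ _
    refine (norm_sum_le _ _).trans (Finset.sum_le_sum fun i _ => ?_)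
    rw [norm_smul]
    exact mul_le_of_le_one_right (norm_nonneg _) (hx i))

lemma A0_apply {X : Type*} [NormedAddCommGroup X] [NormedSpace ℝ X] {k : ℕ} (x : Fin k → X)
    (hx : ∀ i, ‖x i‖ ≤ 1) (a : ell1 k) : A0 x hx a = ∑ i, a i • x i := rfl

lemma A0_norm {X : Type*} [NormedAddCommGroup X] [NormedSpace ℝ X] {k : ℕ} (x : Fin k → X)
    (hx : ∀ i, ‖x i‖ ≤ 1) : ‖A0 x hx‖ ≤ 1 :=
  LinearMap.mkContinuous_norm_le _ zero_le_one _

/-- Diagonally dominant matrices are bounded below on `ℓ₁ᵏ`. -/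
lemma diag_dom {k : ℕ} (M : Fin k → Fin k → ℝ) (δ : ℝ)
    (hdiag : ∀ i, δ ≤ M i i) (hoff : ∀ i, ∑ j ∈ Finset.univ.erase i, |M i j| ≤ δ / 2)
    (a : Fin k → ℝ) : δ / 2 * ∑ i, |a i| ≤ ∑ j, |∑ i, a i * M i j| := by
  have h1 : ∀ j, |a j| * δ - ∑ i ∈ Finset.univ.erase j, |a i| * |M i j|
      ≤ |∑ i, a i * M i j| := by
    intro j
    rw [← Finset.add_sum_erase _ _ (Finset.mem_univ j)]
    have h2 : |∑ i ∈ Finset.univ.erase j, a i * M i j|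
        ≤ ∑ i ∈ Finset.univ.erase j, |a i| * |M i j| :=
      (Finset.abs_sum_le_sum_abs _ _).trans (le_of_eq (by simp [abs_mul]))
    have h3 : |a j| * δ ≤ |a j * M j j| := by
      rw [abs_mul]
      exact mul_le_mul_of_nonneg_left ((hdiag j).trans (le_abs_self _)) (abs_nonneg _)
    have h4 := abs_sub_abs_le_abs_sub (a j * M j j) (-∑ i ∈ Finset.univ.erase j, a i * M i j)
    rw [abs_neg, sub_neg_eq_add] at h4
    linarith
  have h5 : ∑ j, ∑ i ∈ Finset.univ.erase j, |a i| * |M i j|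
      = ∑ i, ∑ j ∈ Finset.univ.erase i, |a i| * |M i j| := by
    apply Finset.sum_comm'
    intro i j; simp [eq_comm]
  have h6 : ∑ i, ∑ j ∈ Finset.univ.erase i, |a i| * |M i j| ≤ ∑ i, |a i| * (δ / 2) := by
    refine Finset.sum_le_sum fun i _ => ?_
    rw [← Finset.mul_sum]
    exact mul_le_mul_of_nonneg_left (hoff i) (abs_nonneg _)
  have h7 := Finset.sum_le_sum fun j (_ : j ∈ Finset.univ) => h1 j
  rw [Finset.sum_sub_distrib, h5, ← Finset.sum_mul] at h7
  rw [← Finset.sum_mul] at h6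
  linarith

/-- Operators bounded below on `ℓ₁ᵏ` have inverses bounded above. -/
lemma inv_exists {k : ℕ} (M : ell1 k →L[ℝ] ell1 k) (c : ℝ) (hc : 0 < c)
    (hM : ∀ a, c * ‖a‖ ≤ ‖M a‖) :
    ∃ N : ell1 k →L[ℝ] ell1 k, N.comp M = ContinuousLinearMap.id ℝ _ ∧ ‖N‖ ≤ c⁻¹ := by
  have hinj : Function.Injective (M : ell1 k →ₗ[ℝ] ell1 k) := by
    rw [← LinearMap.ker_eq_bot, LinearMap.ker_eq_bot']
    intro a ha
    have h1 := hM a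
    have h2 : M a = 0 := ha
    rw [h2, norm_zero] at h1
    have : ‖a‖ ≤ 0 := by
      by_contra hh
      push Not at hh
      have := mul_pos hc hh
      linarith
    exact norm_le_zero_iff.1 this
  let e := LinearEquiv.ofInjectiveEndo (M : ell1 k →ₗ[ℝ] ell1 k) hinj
  have he : ∀ a, e a = M a := fun a => rfl
  refine ⟨LinearMap.mkContinuous (e.symm : ell1 k →ₗ[ℝ] ell1 k) c⁻¹ ?_, ?_, ?_⟩
  · intro b
    have h1 := hM (e.symm b)
    rw [← he, e.apply_symm_apply] at h1
    rw [inv_mul_eq_div, le_div_iff₀ hc, mul_comm]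
    exact h1
  · refine ContinuousLinearMap.ext fun a => ?_
    change e.symm (M a) = a
    rw [← he, e.symm_apply_apply]
  · exact LinearMap.mkContinuous_norm_le _ (by positivity) _

/-- **Almost disjointly supported images give uniform factorization.** Let
`T_m : X_m → L¹` with `‖T_m‖ ≤ 1`. If there is `δ > 0` such that for every `n` one can find
`m`, unit-ball elements `x₁,…,x_n` of `X_m`, and pairwise disjoint measurable sets
`E₁,…,E_n ⊆ [0,1]` with `‖(T_m xᵢ)·1_{Eᵢ}‖₁ ≥ δ`, then the identity operators on `ℓ₁ᵏ`
uniformly factor through the `T_m`. -/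
theorem almost_disjoint_support_implies_factorization {X : ℕ → Type*}
    [∀ m, NormedAddCommGroup (X m)] [∀ m, NormedSpace ℝ (X m)] [∀ m, CompleteSpace (X m)]
    (T : ∀ m, X m →L[ℝ] L1) (hT : ∀ m, ‖T m‖ ≤ 1)
    (δ : ℝ) (hδ : 0 < δ)
    (h : ∀ n : ℕ, ∃ m : ℕ, ∃ x : Fin n → X m, ∃ E : Fin n → Set ℝ,
      (∀ i, ‖x i‖ ≤ 1) ∧ (∀ i, MeasurableSet (E i)) ∧ (∀ i, E i ⊆ Set.Icc 0 1) ∧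
      Pairwise (Function.onFun Disjoint E) ∧
      (∀ i, δ ≤ ∫ t in E i, |(T m (x i) : ℝ → ℝ) t| ∂μ01)) :
    ∃ C : ℝ, 0 < C ∧ ∀ k : ℕ, ∃ m : ℕ, ∃ A : ell1 k →L[ℝ] X m, ∃ B : L1 →L[ℝ] ell1 k,
      B.comp ((T m).comp A) = ContinuousLinearMap.id ℝ (ell1 k) ∧ ‖A‖ * ‖B‖ ≤ C := by
  refine ⟨2 / δ, by positivity, fun k => ?_⟩
  obtain ⟨ε, hε, hεk⟩ : ∃ ε : ℝ, 0 < ε ∧ k * ε ≤ δ / 2 := by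
    refine ⟨δ / 2 / (k + 1), by positivity, ?_⟩
    rw [← mul_div_assoc, div_le_iff₀ (by positivity)]
    nlinarith
  obtain ⟨D, hD⟩ := exists_nat_ge (2 / ε + 1)
  obtain ⟨m, x, E, hx, hE, -, hd, hδE⟩ := h (k * D)
  have hTx : ∀ i, ‖T m (x i)‖ ≤ 1 := fun i =>
    ((T m).le_of_opNorm_le (hT m) _).trans (by rw [one_mul]; exact hx i)
  obtain ⟨S, -, hSc, hS⟩ := greedy_aux
    (fun i j => ∫ t in E j, |(T m (x i) : ℝ → ℝ) t| ∂μ01)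
    (fun i j => integral_nonneg fun t => abs_nonneg _) ε hε D hD k Finset.univ
    (fun i => (sum_setInt_le E hE hd _).trans (hTx i)) (by simp)
  let φ := S.orderEmbOfFin hSc
  have hφS : ∀ i, φ i ∈ S := fun i => S.orderEmbOfFin_mem hSc i
  have hφ : Function.Injective φ := φ.injective
  have hd' : Pairwise (Function.onFun Disjoint (fun i => E (φ i))) :=
    fun i j hij => hd (hφ.ne hij)
  let A := A0 (fun i => x (φ i)) (fun i => hx _)
  let B := B0 (fun i => E (φ i)) (fun i => hE _) hd' (fun i => T m (x (φ i)))
  let M : Fin k → Fin k → ℝ := fun i j => B (T m (x (φ i))) j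
  have hM1 : ∀ i, δ ≤ M i i := by
    intro i
    refine (hδE (φ i)).trans (le_of_eq ?_)
    simp only [M, B, B0_apply, sgn_mul]
  have hM2 : ∀ i, ∑ j ∈ Finset.univ.erase i, |M i j| ≤ δ / 2 := by
    intro i
    have h1 : ∀ j ∈ Finset.univ.erase i, |M i j| ≤ ε := by
      intro j hj
      refine (abs_sgn_int_le _ _ _).trans ?_
      exact hS _ (hφS i) _ (hφS j) (hφ.ne (Finset.ne_of_mem_erase hj).symm)
    refine (Finset.sum_le_card_nsmul _ _ _ h1).trans (le_trans ?_ hεk)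
    rw [nsmul_eq_mul]
    refine mul_le_mul_of_nonneg_right ?_ hε.le
    have := Finset.card_le_univ (Finset.univ.erase i)
    rw [Fintype.card_fin] at this
    exact_mod_cast this
  obtain ⟨N, hN, hNn⟩ := inv_exists (B.comp ((T m).comp A)) (δ / 2) (by positivity) (by
    intro a
    have := diag_dom M δ hM1 hM2 a
    rw [PiLp.norm_eq_of_L1, PiLp.norm_eq_of_L1]
    refine this.trans (le_of_eq (Finset.sum_congr rfl fun j _ => ?_))
    rw [Real.norm_eq_abs]
    congr 1
    simp only [ContinuousLinearMap.comp_apply, A, A0_apply, map_sum, map_smul]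
    simp [M])
  refine ⟨m, A, N.comp B, ?_, ?_⟩
  · rw [← hN]; rfl
  · have h1 : ‖N.comp B‖ ≤ 2 / δ := by
      refine (N.opNorm_comp_le B).trans ?_
      refine (mul_le_of_le_one_right (norm_nonneg _) (B0_norm _ _ _ _)).trans ?_
      rwa [inv_div] at hNn
    exact (mul_le_of_le_one_left (norm_nonneg _) (A0_norm _ _)).trans h1

end
end
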